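/- arXiv:1612.08627 — 5 statements merged into one kernel-verified Lean document; each statement's English description precedes it below -/
import Mathlib

section
/- Assume the Riemann Hypothesis. Let {γ₋, γ₊} be a pair of consecutive simple zeros of Hardy's Z-function. If ĝ_{γ₋,γ₊} < 4/5 − 3(γ₊−γ₋)²(1/γ₋² + 1/γ₊²), then {γ₋, γ₊} is a Lehmer pair. -/
open Complex

/-- The Riemann–Siegel theta function
`ϑ(t) = (1/(2i)) log (Γ(1/4+it/2)/Γ(1/4−it/2)) − (t/2) log π` (real-valued for real `t`). -/
noncomputable def RStheta (t : ℝ) : ℝ :=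
  (1 / (2 * Complex.I) * Complex.log (Complex.Gamma (1 / 4 + Complex.I * t / 2) /
      Complex.Gamma (1 / 4 - Complex.I * t / 2))).re - t / 2 * Real.log Real.pi

/-- Hardy's Z-function `Z(t) = e^{iϑ(t)} ζ(1/2+it)` (real-valued for real `t`). -/
noncomputable def HardyZ (t : ℝ) : ℝ :=
  (Complex.exp (Complex.I * RStheta t) * riemannZeta (1 / 2 + Complex.I * t)).re

/-- `γ` is a simple zero of Hardy's Z-function. -/
def IsSimpleZeroZ (γ : ℝ) : Prop := HardyZ γ = 0 ∧ deriv HardyZ γ ≠ 0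

/-- `F̂(t) = −(Z'''/Z')(t) + (3/4)((Z''/Z')(t))²`. -/
noncomputable def Fhat (t : ℝ) : ℝ :=
  -(iteratedDeriv 3 HardyZ t / deriv HardyZ t) +
    3 / 4 * (iteratedDeriv 2 HardyZ t / deriv HardyZ t) ^ 2

/-- `ĝ_{γ₁,γ₂} = (1/3)(γ₁−γ₂)²(F̂(γ₁)+F̂(γ₂)) − 2`. -/
noncomputable def ghat (γ₁ γ₂ : ℝ) : ℝ :=
  1 / 3 * (γ₁ - γ₂) ^ 2 * (Fhat γ₁ + Fhat γ₂) - 2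

/-- `ḡ_{γ₁,γ₂} = (γ₁−γ₂)² Σ_{γ∉{γ₁,γ₂}} [1/(γ−γ₁)² + 1/(γ−γ₂)²]`, the sum running over
all zeros `γ` of the Z-function other than `γ₁, γ₂`. -/
noncomputable def gbar (γ₁ γ₂ : ℝ) : ℝ :=
  (γ₁ - γ₂) ^ 2 * ∑' γ : {γ : ℝ // HardyZ γ = 0 ∧ γ ≠ γ₁ ∧ γ ≠ γ₂},
    (1 / ((γ : ℝ) - γ₁) ^ 2 + 1 / ((γ : ℝ) - γ₂) ^ 2)

/-- A Lehmer pair: a pair `γ₋ < γ₊` of consecutive simple (positive) zeros of the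
Z-function with `ḡ_{γ₋,γ₊} < 4/5`. -/
def IsLehmerPair (γm γp : ℝ) : Prop :=
  0 < γm ∧ γm < γp ∧ IsSimpleZeroZ γm ∧ IsSimpleZeroZ γp ∧
    (∀ t : ℝ, γm < t → t < γp → HardyZ t ≠ 0) ∧ gbar γm γp < 4 / 5

open Filter Topology Metric

/-- Borel–Carathéodory estimate for the second logarithmic derivative of a zero-free function. -/
theorem norm_deriv_logDeriv_le {g : ℂ → ℂ} {c : ℂ} {r M : ℝ} (hr : 0 < r) (hM : 0 < M)
    (hg : DifferentiableOn ℂ g (ball c r)) (hg0 : ∀ z ∈ ball c r, g z ≠ 0)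
    (hb : ∀ z ∈ ball c r, ‖g z‖ ≤ ‖g c‖ * Real.exp M) :
    ‖deriv (logDeriv g) c‖ ≤ 16 * M / r ^ 2 := by
  have hc : c ∈ ball c r := mem_ball_self hr
  have hL : DifferentiableOn ℂ (logDeriv g) (ball c r) :=
    (hg.deriv isOpen_ball).div hg hg0
  obtain ⟨F₀, hF₀⟩ := hL.isExactOn_ball
  set F : ℂ → ℂ := fun z => F₀ z - F₀ c with hFdef
  have hF : ∀ z ∈ ball c r, HasDerivAt F (logDeriv g z) z := fun z hz =>
    (hF₀ z hz).sub_const _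
  have hFc : F c = 0 := by simp [hFdef]
  have hexp : ∀ z ∈ ball c r, g z = g c * Complex.exp (F z) := by
    have hd : ∀ z ∈ ball c r, HasDerivAt (fun z => g z * Complex.exp (-F z)) 0 z := by
      intro z hz
      have h1 := (hg.differentiableAt (isOpen_ball.mem_nhds hz)).hasDerivAt
      refine (h1.mul (hF z hz).fun_neg.cexp).congr_deriv ?_
      have := hg0 z hz
      simp only [logDeriv_apply]
      field_simp
      ring
    intro z hz
    have h2 : g z * Complex.exp (-F z) = g c * Complex.exp (-F c) :=
      isOpen_ball.is_const_of_deriv_eq_zero (convex_ball c r).isPreconnected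
        (fun w hw => (hd w hw).differentiableAt.differentiableWithinAt)
        (fun w hw => (hd w hw).deriv) hz hc
    rw [hFc, neg_zero, Complex.exp_zero, mul_one] at h2
    rw [← h2, mul_assoc, ← Complex.exp_add]
    simp
  have hre : ∀ z ∈ ball c r, (F z).re ≤ M := by
    intro z hz
    have h1 := hb z hz
    rw [hexp z hz, norm_mul, Complex.norm_exp] at h1
    exact Real.exp_le_exp.1 (le_of_mul_le_mul_left h1 (norm_pos_iff.2 (hg0 c hc)))
  have hFdiff : DifferentiableOn ℂ F (ball c r) := fun z hz =>
    (hF z hz).differentiableAt.differentiableWithinAt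
  have hmem : ∀ w ∈ ball (0 : ℂ) r, c + w ∈ ball c r := by
    intro w hw
    simpa using hw
  have hFb : ∀ z ∈ sphere c (r / 2), ‖F z‖ ≤ 2 * M := by
    intro z hz
    have hzn : ‖z - c‖ = r / 2 := by simpa [dist_eq_norm] using hz
    have := Complex.borelCaratheodory_zero (f := fun w => F (c + w)) (z := z - c) hM
      (hFdiff.comp (by fun_prop) hmem) (fun w hw => hre _ (hmem w hw)) hr
      (by rw [mem_ball_zero_iff, hzn]; linarith) (by simp [hFc])
    simp only [add_sub_cancel, hzn] at this
    refine this.trans (le_of_eq ?_)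
    field_simp
    ring
  have hsub : closedBall c (r / 2) ⊆ ball c r := closedBall_subset_ball (by linarith)
  have h2 := Complex.norm_iteratedDeriv_le_of_forall_mem_sphere_norm_le (F := ℂ) 2
    (half_pos hr) (hFdiff.diffContOnCl_ball hsub) hFb
  have h3 : iteratedDeriv 2 F c = deriv (logDeriv g) c := by
    rw [iteratedDeriv_succ, iteratedDeriv_one]
    apply Filter.EventuallyEq.deriv_eq
    filter_upwards [isOpen_ball.mem_nhds hc] with z hz using (hF z hz).deriv
  rw [h3] at h2
  refine h2.trans (le_of_eq ?_)
  simp only [Nat.factorial]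
  field_simp
  ring

/-- The second logarithmic derivative of a product is the sum of those of the factors. -/
theorem deriv_logDeriv_mul {f g : ℂ → ℂ} {x : ℂ} (hf : AnalyticAt ℂ f x) (hg : AnalyticAt ℂ g x)
    (hf0 : f x ≠ 0) (hg0 : g x ≠ 0) :
    deriv (logDeriv fun z => f z * g z) x = deriv (logDeriv f) x + deriv (logDeriv g) x := by
  have h : logDeriv (fun z => f z * g z) =ᶠ[𝓝 x] fun z => logDeriv f z + logDeriv g z := by
    filter_upwards [hf.eventually_analyticAt, hg.eventually_analyticAt,
      hf.continuousAt.eventually_ne hf0, hg.continuousAt.eventually_ne hg0] with z h1 h2 h3 h4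
    exact logDeriv_mul z h3 h4 h1.differentiableAt h2.differentiableAt
  rw [h.deriv_eq]
  exact deriv_fun_add (hf.deriv.div hf hf0).differentiableAt
    (hg.deriv.div hg hg0).differentiableAt

theorem deriv_logDeriv_inv {f : ℂ → ℂ} {x : ℂ} (hf : AnalyticAt ℂ f x) (hf0 : f x ≠ 0) :
    deriv (logDeriv fun z => (f z)⁻¹) x = -deriv (logDeriv f) x := by
  have h := deriv_logDeriv_mul hf (hf.fun_inv hf0) hf0 (inv_ne_zero hf0)
  have h1 : logDeriv (fun z => f z * (f z)⁻¹) =ᶠ[𝓝 x] fun _ => 0 := by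
    have h2 : (fun z => f z * (f z)⁻¹) =ᶠ[𝓝 x] fun _ => 1 := by
      filter_upwards [hf.continuousAt.eventually_ne hf0] with z hz using mul_inv_cancel₀ hz
    filter_upwards [h2.deriv] with z hz
    simp [logDeriv_apply, hz]
  rw [h1.deriv_eq, deriv_const] at h
  linear_combination -h

theorem deriv_logDeriv_pow {f : ℂ → ℂ} {x : ℂ} (hf : AnalyticAt ℂ f x) (n : ℕ) :
    deriv (logDeriv fun z => f z ^ n) x = n * deriv (logDeriv f) x := by
  have h : logDeriv (fun z => f z ^ n) =ᶠ[𝓝 x] fun z => (n : ℂ) * logDeriv f z := by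
    filter_upwards [hf.eventually_analyticAt] with z h1
    exact logDeriv_fun_pow h1.differentiableAt n
  rw [h.deriv_eq, deriv_const_mul_field]

theorem deriv_logDeriv_linear {a b x : ℂ} (h : a * x + b ≠ 0) :
    deriv (logDeriv fun z => a * z + b) x = -a ^ 2 / (a * x + b) ^ 2 := by
  have hd : ∀ z, HasDerivAt (fun z => a * z + b) a z := fun z => by
    simpa using ((hasDerivAt_id z).const_mul a).add_const b
  have h1 : logDeriv (fun z => a * z + b) = fun z => a / (a * z + b) := by
    ext z
    rw [logDeriv_apply, (hd z).deriv]
  rw [h1, ((hasDerivAt_const x a).fun_div (hd x) h).deriv]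
  ring

/-- A nonzero zero `ρ` of an entire function can be divided out with multiplicity, without changing
the value at a given point `x`. -/
theorem exists_eq_pow_mul_of_differentiable {f : ℂ → ℂ} (hf : Differentiable ℂ f) {x ρ : ℂ}
    (hx : f x ≠ 0) (hρ : f ρ = 0) :
    ∃ (n : ℕ) (g : ℂ → ℂ), 1 ≤ n ∧ Differentiable ℂ g ∧ g ρ ≠ 0 ∧
      ∀ z, f z = ((z - ρ) / (x - ρ)) ^ n * g z := by
  have hne : x - ρ ≠ 0 := by
    intro h
    rw [sub_eq_zero.1 h] at hx
    exact hx hρ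
  have hfa : AnalyticOnNhd ℂ f Set.univ := fun z _ => hf.analyticAt z
  have hnz : ¬∀ᶠ z in 𝓝 ρ, f z = 0 := by
    intro h
    have := hfa.eqOn_zero_of_preconnected_of_eventuallyEq_zero isPreconnected_univ
      (Set.mem_univ ρ) h
    exact hx (this (Set.mem_univ x))
  obtain ⟨n, h, hha, hh0, hfh⟩ :=
    (AnalyticAt.exists_eventuallyEq_pow_smul_nonzero_iff (hf.analyticAt ρ)).2 hnz
  have hn : 1 ≤ n := by
    by_contra hn
    have := hfh.self_of_nhds
    rw [hρ, Nat.lt_one_iff.1 (not_le.1 hn)] at this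
    simp at this
    exact hh0 this.symm
  have hkey : ∀ z, z ≠ ρ → ((z - ρ) / (x - ρ)) ^ n ≠ 0 := fun z hz =>
    pow_ne_zero _ (div_ne_zero (sub_ne_zero.2 hz) hne)
  classical
  set g : ℂ → ℂ := fun z =>
    if z = ρ then (x - ρ) ^ n * h ρ else f z / ((z - ρ) / (x - ρ)) ^ n with hg
  have hgne : ∀ z, z ≠ ρ → g z = f z / ((z - ρ) / (x - ρ)) ^ n := fun z hz => by simp [hg, hz]
  have hgρ : g ρ = (x - ρ) ^ n * h ρ := by simp [hg]
  have hgh : g =ᶠ[𝓝 ρ] fun z => (x - ρ) ^ n * h z := by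
    filter_upwards [hfh] with z hz
    rcases eq_or_ne z ρ with rfl | hzρ
    · exact hgρ
    · rw [hgne z hzρ, hz, div_pow, smul_eq_mul]
      have := sub_ne_zero.2 hzρ
      field_simp
  refine ⟨n, g, hn, fun z => ?_, ?_, fun z => ?_⟩
  · rcases eq_or_ne z ρ with rfl | hzρ
    · exact (hha.differentiableAt.const_mul _).congr_of_eventuallyEq hgh
    · have : g =ᶠ[𝓝 z] fun z => f z / ((z - ρ) / (x - ρ)) ^ n := by
        filter_upwards [eventually_ne_nhds hzρ] with w hw using hgne w hw
      refine DifferentiableAt.congr_of_eventuallyEq ?_ this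
      exact (hf z).fun_div (by fun_prop) (hkey z hzρ)
  · rw [hgρ]
    exact mul_ne_zero (pow_ne_zero _ hne) hh0
  · rcases eq_or_ne z ρ with rfl | hzρ
    · rw [hρ, sub_self, zero_div, zero_pow (by omega), zero_mul]
    · rw [hgne z hzρ, mul_div_cancel₀ _ (hkey z hzρ)]

/-- Dividing out finitely many real zeros of an entire function. -/
theorem exists_zeroFree_quotient (x : ℝ) {R : ℝ} (T : Finset ℝ) :
    ∀ f : ℂ → ℂ, Differentiable ℂ f → f x ≠ 0 → (∀ ρ ∈ T, f ρ = 0) → (∀ ρ ∈ T, |ρ - x| ≤ R) →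
      (∀ z ∈ closedBall (x : ℂ) R, f z = 0 → ∃ ρ ∈ T, z = (ρ : ℂ)) →
      ∃ g : ℂ → ℂ, Differentiable ℂ g ∧ g x = f x ∧ (∀ z ∈ closedBall (x : ℂ) R, g z ≠ 0) ∧
        (deriv (logDeriv f) x).re ≤
          (deriv (logDeriv g) x).re - ∑ ρ ∈ T, 1 / (x - ρ) ^ 2 ∧
        ∀ z : ℂ, 2 * R ≤ ‖z - x‖ → ‖g z‖ ≤ ‖f z‖ := by
  induction T using Finset.induction_on with
  | empty =>
    intro f hf hx _ _ hz
    refine ⟨f, hf, rfl, fun z hzb h0 => ?_, by simp, fun z _ => le_rfl⟩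
    obtain ⟨ρ, hρ, _⟩ := hz z hzb h0
    simp at hρ
  | insert ρ T hρT ih =>
    intro f hf hx hT hTR hz
    obtain ⟨n, f₁, hn, hf₁, hf₁ρ, heq⟩ :=
      exists_eq_pow_mul_of_differentiable hf hx (hT ρ (Finset.mem_insert_self ρ T))
    have hxρ : (x : ℂ) - ρ ≠ 0 := by
      intro h
      have h1 := hT ρ (Finset.mem_insert_self ρ T)
      rw [← sub_eq_zero.1 h] at h1
      exact hx h1
    have hxρ' : x - ρ ≠ 0 := by exact_mod_cast hxρ
    have hf₁x : f₁ x = f x := by rw [heq, div_self hxρ, one_pow, one_mul]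
    obtain ⟨g, hg, hgx, hg0, hgD, hgn⟩ := ih f₁ hf₁ (hf₁x ▸ hx)
      (fun σ hσ => by
        have h1 := hT σ (Finset.mem_insert_of_mem hσ)
        rw [heq] at h1
        refine (mul_eq_zero.1 h1).resolve_left (pow_ne_zero _ (div_ne_zero ?_ hxρ))
        intro h2
        have h3 : σ = ρ := by exact_mod_cast sub_eq_zero.1 h2
        exact hρT (h3 ▸ hσ))
      (fun σ hσ => hTR σ (Finset.mem_insert_of_mem hσ))
      (fun z hzb h0 => by
        obtain ⟨σ, hσ, rfl⟩ := hz z hzb (by rw [heq, h0, mul_zero])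
        rcases Finset.mem_insert.1 hσ with rfl | h
        · exact absurd h0 hf₁ρ
        · exact ⟨σ, h, rfl⟩)
    refine ⟨g, hg, hgx.trans hf₁x, hg0, ?_, fun z hzR => (hgn z hzR).trans ?_⟩
    · have hlin : (fun z : ℂ => (z - ρ) / (x - ρ)) =
          fun z => ((x : ℂ) - ρ)⁻¹ * z + (-(ρ : ℂ) / (x - ρ)) := by
        ext z
        field_simp
        ring
      have hval : ((x : ℂ) - ρ)⁻¹ * x + (-(ρ : ℂ) / (x - ρ)) = 1 := by
        field_simp
        ring
      have hlinA : AnalyticAt ℂ (fun z : ℂ => (z - ρ) / (x - ρ)) x := by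
        rw [hlin]
        fun_prop
      have hD : deriv (logDeriv f) x = n * -(1 / (x - ρ) ^ 2) + deriv (logDeriv f₁) x := by
        rw [funext heq, deriv_logDeriv_mul (hlinA.fun_pow n) (hf₁.analyticAt _)
          (by simp [div_self hxρ]) (hf₁x ▸ hx), deriv_logDeriv_pow hlinA, hlin,
          deriv_logDeriv_linear (by rw [hval]; exact one_ne_zero), hval]
        field_simp
      have hDre : (deriv (logDeriv f) x).re =
          -(n * (1 / (x - ρ) ^ 2)) + (deriv (logDeriv f₁) x).re := by
        rw [hD, Complex.add_re]
        congr 1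
        have : (n * -(1 / ((x : ℂ) - ρ) ^ 2)) = ((-(n * (1 / (x - ρ) ^ 2)) : ℝ) : ℂ) := by
          push_cast
          ring
        rw [this, Complex.ofReal_re]
      rw [hDre, Finset.sum_insert hρT]
      have h1 : (1 : ℝ) ≤ n := by exact_mod_cast hn
      have h2 : 0 ≤ 1 / (x - ρ) ^ 2 := by positivity
      nlinarith
    · rw [heq z, norm_mul, norm_pow, norm_div]
      have h1 : ‖(x : ℂ) - ρ‖ ≤ R := by
        have := hTR ρ (Finset.mem_insert_self ρ T)
        rwa [← Complex.ofReal_sub, Complex.norm_real, Real.norm_eq_abs, abs_sub_comm]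
      have h2 : ‖(x : ℂ) - ρ‖ ≤ ‖z - ρ‖ := by
        have h3 : ‖z - x‖ ≤ ‖z - ρ‖ + ‖(x : ℂ) - ρ‖ := by
          have := norm_sub_le (z - ρ) ((x : ℂ) - ρ)
          rwa [sub_sub_sub_cancel_right] at this
        linarith
      have h4 : 1 ≤ (‖z - ρ‖ / ‖(x : ℂ) - ρ‖) ^ n :=
        one_le_pow₀ ((one_le_div (norm_pos_iff.2 hxρ)).2 h2)
      nlinarith [norm_nonneg (f₁ z)]

/-- An entire function with real zeros only, of growth `exp (o(|z|²))`: minus its second logarithmic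
derivative at a real point is bounded below by the contribution of any finite set of zeros. -/
theorem sum_le_neg_deriv_logDeriv {f : ℂ → ℂ} (hf : Differentiable ℂ f)
    (hgr : ∀ ε > 0, ∀ᶠ z in Bornology.cobounded ℂ, ‖f z‖ ≤ Real.exp (ε * ‖z‖ ^ 2))
    (hreal : ∀ z, f z = 0 → z.im = 0) {x : ℝ} (hx : f x ≠ 0) {S : Finset ℝ}
    (hS : ∀ ρ ∈ S, f ρ = 0) :
    ∑ ρ ∈ S, 1 / (x - ρ) ^ 2 ≤ -(deriv (logDeriv f) x).re := by
  refine le_of_forall_pos_le_add fun δ hδ => ?_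
  obtain ⟨ε, hε, hεδ⟩ : ∃ ε > 0, 160 * ε ≤ δ := ⟨δ / 160, by positivity, by linarith⟩
  obtain ⟨R₀, hR₀⟩ : ∃ R₀ : ℝ, ∀ z : ℂ, R₀ ≤ ‖z‖ → ‖f z‖ ≤ Real.exp (ε * ‖z‖ ^ 2) := by
    have := hgr ε hε
    rw [← comap_norm_atTop, eventually_comap] at this
    obtain ⟨R₀, h⟩ := eventually_atTop.1 this
    exact ⟨R₀, fun z hz => h _ hz z rfl⟩
  have hlim : Tendsto (fun R : ℝ => ε * R ^ 2) atTop atTop :=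
    (tendsto_pow_atTop two_ne_zero).const_mul_atTop hε
  obtain ⟨R, hR1, hR2, hR3, hR4, hR5⟩ : ∃ R : ℝ, 0 < R ∧ R₀ + |x| ≤ 2 * R ∧ |x| ≤ R ∧
      -Real.log ‖f x‖ ≤ ε * R ^ 2 ∧ ∀ ρ ∈ S, |ρ - x| ≤ R := by
    have h5 : ∀ᶠ R : ℝ in atTop, ∀ ρ ∈ S, |ρ - x| ≤ R := by
      rw [Filter.eventually_all_finset]
      exact fun ρ _ => eventually_ge_atTop _
    exact ((eventually_gt_atTop 0).and (((eventually_ge_atTop ((R₀ + |x|) / 2)).mono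
      fun R h => by linarith).and ((eventually_ge_atTop |x|).and
      ((hlim.eventually_ge_atTop _).and h5)))).exists
  have hfin : {ρ : ℝ | f ρ = 0 ∧ |ρ - x| ≤ R}.Finite := by
    have hfa : AnalyticOnNhd ℂ f Set.univ := fun z _ => hf.analyticAt z
    have hcod := hfa.preimage_zero_mem_codiscrete (x := (x : ℂ)) hx
    have h2 : (closedBall (x : ℂ) R ∩ f ⁻¹' {0}).Finite := by
      have := (isCompact_closedBall (x : ℂ) R).finite_sdiff_of_mem_codiscreteWithin
        (codiscreteWithin_mono (Set.subset_univ _) hcod)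
      rwa [Set.sdiff_eq, ← Set.preimage_compl, compl_compl] at this
    refine (h2.preimage (f := fun ρ : ℝ => (ρ : ℂ)) Complex.ofReal_injective.injOn).subset ?_
    rintro ρ ⟨h3, h4⟩
    refine ⟨?_, h3⟩
    rwa [mem_closedBall, dist_eq_norm, ← Complex.ofReal_sub, Complex.norm_real, Real.norm_eq_abs]
  set T := hfin.toFinset with hT
  obtain ⟨g, hg, hgx, hg0, hgD, hgn⟩ := exists_zeroFree_quotient x (R := R) T f hf hx
    (fun ρ hρ => (hfin.mem_toFinset.1 hρ).1) (fun ρ hρ => (hfin.mem_toFinset.1 hρ).2)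
    (fun z hzb h0 => by
      have him : z = (z.re : ℂ) := Complex.ext (by simp) (by simp [hreal z h0])
      refine ⟨z.re, hfin.mem_toFinset.2 ⟨him ▸ h0, ?_⟩, him⟩
      rw [him, mem_closedBall, dist_eq_norm, ← Complex.ofReal_sub, Complex.norm_real,
        Real.norm_eq_abs] at hzb
      simpa using hzb)
  have hST : ∑ ρ ∈ S, 1 / (x - ρ) ^ 2 ≤ ∑ ρ ∈ T, 1 / (x - ρ) ^ 2 :=
    Finset.sum_le_sum_of_subset_of_nonneg
      (fun ρ hρ => hfin.mem_toFinset.2 ⟨hS ρ hρ, hR5 ρ hρ⟩) (fun _ _ _ => by positivity)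
  have hbound : ∀ z ∈ closedBall (x : ℂ) (2 * R), ‖g z‖ ≤ Real.exp (9 * ε * R ^ 2) := by
    intro z hz
    refine Complex.norm_le_of_forall_mem_frontier_norm_le (U := ball (x : ℂ) (2 * R))
      isBounded_ball hg.diffContOnCl (fun w hw => ?_) ?_
    · rw [frontier_ball _ (by positivity), mem_sphere, dist_eq_norm] at hw
      have hxn : ‖(x : ℂ)‖ = |x| := by rw [Complex.norm_real, Real.norm_eq_abs]
      have h1 : 2 * R ≤ ‖w‖ + |x| := by
        rw [← hw, ← hxn]
        exact norm_sub_le _ _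
      have h2 : ‖w‖ ≤ 3 * R := by
        have := norm_add_le (w - x) (x : ℂ)
        rw [sub_add_cancel, hw, hxn] at this
        linarith
      refine ((hgn w hw.ge).trans (hR₀ w (by linarith))).trans (Real.exp_le_exp.2 ?_)
      nlinarith [pow_le_pow_left₀ (norm_nonneg w) h2 2]
    · rwa [closure_ball _ (by positivity)]
  have hDg : ‖deriv (logDeriv g) x‖ ≤ 16 * (10 * ε * R ^ 2) / R ^ 2 := by
    refine norm_deriv_logDeriv_le hR1 (by positivity) hg.differentiableOn
      (fun z hz => hg0 z (ball_subset_closedBall hz)) fun z hz => ?_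
    have h1 := hbound z (ball_subset_closedBall (ball_subset_ball (by linarith) hz))
    refine h1.trans ?_
    rw [hgx, ← Real.exp_log (norm_pos_iff.2 hx), ← Real.exp_add]
    exact Real.exp_le_exp.2 (by linarith)
  have hre := (Complex.abs_re_le_norm _).trans hDg
  have h1 : 16 * (10 * ε * R ^ 2) / R ^ 2 = 160 * ε := by
    field_simp
    ring
  rw [h1] at hre
  linarith [(abs_le.1 hre).2]

theorem eventually_factorial_le_exp {ε : ℝ} (hε : 0 < ε) :
    ∀ᶠ n : ℕ in atTop, (n.factorial : ℝ) ≤ Real.exp (ε * (n : ℝ) ^ 2) := by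
  have h := (Real.isLittleO_log_id_atTop.bound hε).natCast_atTop
  filter_upwards [h, eventually_ge_atTop 1] with n hn hn1
  have hpos : (0 : ℝ) < n := by exact_mod_cast hn1
  have h1 : Real.log n ≤ ε * n := by
    have := (le_abs_self _).trans hn
    simpa [abs_of_pos hpos] using this
  calc (n.factorial : ℝ) ≤ (n : ℝ) ^ n := by exact_mod_cast Nat.factorial_le_pow n
    _ = Real.exp (n * Real.log n) := by rw [Real.exp_nat_mul, Real.exp_log hpos]
    _ ≤ _ := Real.exp_le_exp.2 (by nlinarith)

theorem norm_Gamma_le_Gamma_re {s : ℂ} (hs : 0 < s.re) : ‖Complex.Gamma s‖ ≤ Real.Gamma s.re := by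
  rw [Complex.Gamma_eq_integral hs, Complex.GammaIntegral, Real.Gamma_eq_integral hs]
  refine (MeasureTheory.norm_integral_le_integral_norm _).trans (le_of_eq ?_)
  refine MeasureTheory.setIntegral_congr_fun measurableSet_Ioi fun t ht => ?_
  simp only [norm_mul, Complex.norm_cpow_eq_rpow_re_of_pos ht]
  rw [Complex.norm_real, Real.norm_eq_abs, Real.abs_exp]
  simp

theorem norm_Gamma_le_factorial {s : ℂ} {n : ℕ} (h2 : 2 ≤ s.re) (hn : s.re ≤ n + 1) :
    ‖Complex.Gamma s‖ ≤ n.factorial := by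
  rw [← Real.Gamma_nat_eq_factorial]
  exact (norm_Gamma_le_Gamma_re (by linarith)).trans
    (Real.Gamma_strictMonoOn_Ici.monotoneOn h2 (h2.trans hn) hn)

theorem differentiableAt_Gamma_of_re_pos {s : ℂ} (hs : 0 < s.re) :
    DifferentiableAt ℂ Complex.Gamma s := by
  refine Complex.differentiableAt_Gamma s fun m h => ?_
  rw [h] at hs
  simp at hs
  have : (0 : ℝ) ≤ m := m.cast_nonneg
  linarith

theorem analyticAt_Gamma_of_re_pos {s : ℂ} (hs : 0 < s.re) : AnalyticAt ℂ Complex.Gamma s := by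
  rw [Complex.analyticAt_iff_eventually_differentiableAt]
  filter_upwards [(isOpen_lt continuous_const Complex.continuous_re).mem_nhds hs] with z hz
    using differentiableAt_Gamma_of_re_pos hz

theorem deriv_logDeriv_Gamma_add_one {s : ℂ} (hs : 0 < s.re) :
    deriv (logDeriv Complex.Gamma) s = 1 / s ^ 2 + deriv (logDeriv Complex.Gamma) (s + 1) := by
  have hs0 : s ≠ 0 := by
    rintro rfl
    simp at hs
  have h1 : (fun z => Complex.digamma (z + 1)) =ᶠ[𝓝 s] fun z => Complex.digamma z + z⁻¹ := by
    filter_upwards [(isOpen_lt continuous_const Complex.continuous_re).mem_nhds hs] with z hz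
    refine Complex.digamma_apply_add_one z fun m h => ?_
    rw [h] at hz
    simp at hz
    have : (0 : ℝ) ≤ m := m.cast_nonneg
    linarith
  have hd : DifferentiableAt ℂ Complex.digamma s := by
    have ha := analyticAt_Gamma_of_re_pos hs
    exact (ha.deriv.div ha (Complex.Gamma_ne_zero_of_re_pos hs)).differentiableAt
  have h2 := h1.deriv_eq
  rw [deriv_comp_add_const, deriv_fun_add hd (differentiableAt_inv hs0), deriv_inv] at h2
  rw [← Complex.digamma_def, h2]
  field_simp
  ring

theorem tendsto_deriv_logDeriv_Gamma {s : ℂ} (hs : 0 < s.re) {δ : ℝ} (hδ : 0 < δ) :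
    ∀ᶠ N : ℕ in atTop, ‖deriv (logDeriv Complex.Gamma) (s + N)‖ ≤ δ := by
  obtain ⟨ε, hε, hεδ⟩ : ∃ ε > 0, 320 * ε = δ := ⟨δ / 320, by positivity, by ring⟩
  set c : ℝ := ‖Complex.Gamma (s + 1)‖ with hc
  have hc0 : 0 < c := norm_pos_iff.2 (Complex.Gamma_ne_zero_of_re_pos (by simp; linarith))
  have hlow : ∀ n : ℕ, c ≤ ‖Complex.Gamma (s + (n + 1 : ℕ))‖ := by
    intro n
    induction n with
    | zero => simp [hc]
    | succ n ih =>
      refine ih.trans ?_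
      have hre : (1 : ℝ) ≤ (s + (n + 1 : ℕ)).re := by
        simp
        have : (0 : ℝ) ≤ n := n.cast_nonneg
        linarith
      have hne : s + (n + 1 : ℕ) ≠ 0 := by
        intro h
        rw [h] at hre
        simp at hre
        linarith
      have : s + ((n + 1 + 1 : ℕ) : ℂ) = s + (n + 1 : ℕ) + 1 := by push_cast; ring
      rw [this, Complex.Gamma_add_one _ hne, norm_mul]
      have h1 : 1 ≤ ‖s + ((n + 1 : ℕ) : ℂ)‖ := hre.trans (Complex.re_le_norm _)
      nlinarith [norm_nonneg (Complex.Gamma (s + ((n + 1 : ℕ) : ℂ)))]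
  have hfact : ∀ᶠ N : ℕ in atTop, ((2 * N).factorial : ℝ) ≤ Real.exp (ε * ((2 * N : ℕ) : ℝ) ^ 2) :=
    (tendsto_id.const_mul_atTop' (by norm_num : 0 < 2)).eventually (eventually_factorial_le_exp hε)
  have hlim : Tendsto (fun N : ℕ => ε * (N : ℝ) ^ 2) atTop atTop :=
    ((tendsto_pow_atTop two_ne_zero).comp tendsto_natCast_atTop_atTop).const_mul_atTop hε
  filter_upwards [hfact, hlim.eventually_ge_atTop (-Real.log c), eventually_ge_atTop 4,
    tendsto_natCast_atTop_atTop.eventually_ge_atTop (2 * s.re)] with N h1 h2 h3 h4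
  have hN : (4 : ℝ) ≤ N := by exact_mod_cast h3
  have hball : ∀ z ∈ ball (s + N) ((N : ℝ) / 2), 2 ≤ z.re ∧ z.re ≤ ((2 * N : ℕ) : ℝ) + 1 := by
    intro z hz
    rw [mem_ball, dist_eq_norm] at hz
    have h5 := (Complex.abs_re_le_norm _).trans hz.le
    simp only [Complex.sub_re, Complex.add_re, Complex.natCast_re, abs_le] at h5
    push_cast
    constructor <;> linarith [h5.1, h5.2]
  have := norm_deriv_logDeriv_le (g := Complex.Gamma) (c := s + N) (r := N / 2)
    (M := 5 * ε * (N : ℝ) ^ 2) (by linarith) (by positivity)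
    (fun z hz => (differentiableAt_Gamma_of_re_pos
      (by linarith [(hball z hz).1])).differentiableWithinAt)
    (fun z hz => Complex.Gamma_ne_zero_of_re_pos (by linarith [(hball z hz).1])) (fun z hz => by
      refine ((norm_Gamma_le_factorial (hball z hz).1 (hball z hz).2).trans h1).trans ?_
      have h5 := hlow (N - 1)
      rw [Nat.sub_add_cancel (by omega)] at h5
      refine le_trans ?_ (mul_le_mul_of_nonneg_right h5 (Real.exp_nonneg _))
      rw [← Real.exp_log hc0, ← Real.exp_add]
      apply Real.exp_le_exp.2
      push_cast
      linarith)
  refine this.trans (le_of_eq ?_)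
  rw [← hεδ]
  field_simp
  ring

/-- Comparison function for the telescoping estimate of the trigamma series. -/
noncomputable def trigammaMajorant (a b : ℝ) : ℝ :=
  a / (a ^ 2 + b ^ 2) + (a ^ 2 - b ^ 2) / (2 * (a ^ 2 + b ^ 2) ^ 2) + 1 / (3 * (a ^ 2 + b ^ 2))

theorem re_inv_sq_le_trigammaMajorant_sub {a b : ℝ} (ha : 1 / 4 ≤ a) :
    (a ^ 2 - b ^ 2) / (a ^ 2 + b ^ 2) ^ 2 ≤ trigammaMajorant a b - trigammaMajorant (a + 1) b := by
  have hm : 0 < a ^ 2 + b ^ 2 := by positivity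
  have hm' : 0 < (a + 1) ^ 2 + b ^ 2 := by positivity
  have hid : trigammaMajorant a b - trigammaMajorant (a + 1) b -
      (a ^ 2 - b ^ 2) / (a ^ 2 + b ^ 2) ^ 2 =
      ((2 * a + 1) / 3 * ((a ^ 2 + b ^ 2) * ((a + 1) ^ 2 + b ^ 2)) -
        ((a * (a + 1) - b ^ 2) ^ 2 - (b * (2 * a + 1)) ^ 2) / 2) /
        ((a ^ 2 + b ^ 2) * ((a + 1) ^ 2 + b ^ 2)) ^ 2 := by
    unfold trigammaMajorant
    field_simp
    ring
  have h0 : 0 ≤ (2 * a + 1) / 3 * ((a ^ 2 + b ^ 2) * ((a + 1) ^ 2 + b ^ 2)) -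
      ((a * (a + 1) - b ^ 2) ^ 2 - (b * (2 * a + 1)) ^ 2) / 2 := by
    have h1 : (a ^ 2 + b ^ 2) * ((a + 1) ^ 2 + b ^ 2) =
        (a * (a + 1) - b ^ 2) ^ 2 + (b * (2 * a + 1)) ^ 2 := by ring
    rw [h1]
    nlinarith [sq_nonneg (a * (a + 1) - b ^ 2), sq_nonneg (b * (2 * a + 1))]
  have := div_nonneg h0 (sq_nonneg ((a ^ 2 + b ^ 2) * ((a + 1) ^ 2 + b ^ 2)))
  linarith

theorem re_one_div_sq (s : ℂ) :
    (1 / s ^ 2).re = (s.re ^ 2 - s.im ^ 2) / (s.re ^ 2 + s.im ^ 2) ^ 2 := by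
  rw [one_div, Complex.inv_re, map_pow, Complex.normSq_apply]
  simp [pow_two]

theorem re_deriv_logDeriv_Gamma_le {s : ℂ} (hs : 1 / 4 ≤ s.re) :
    (deriv (logDeriv Complex.Gamma) s).re ≤ trigammaMajorant s.re s.im := by
  have hstep : ∀ N : ℕ, (deriv (logDeriv Complex.Gamma) s).re - trigammaMajorant s.re s.im ≤
      (deriv (logDeriv Complex.Gamma) (s + N)).re - trigammaMajorant (s.re + N) s.im := by
    intro N
    induction N with
    | zero => simp
    | succ N ih =>
      refine ih.trans ?_
      have hN : (0 : ℝ) ≤ N := N.cast_nonneg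
      have h1 := deriv_logDeriv_Gamma_add_one (s := s + N) (by simp; linarith)
      have h2 := congrArg Complex.re h1
      rw [Complex.add_re, re_one_div_sq] at h2
      have h3 := re_inv_sq_le_trigammaMajorant_sub (a := s.re + N) (b := s.im) (by linarith)
      simp only [Complex.add_re, Complex.natCast_re, Complex.add_im, Complex.natCast_im,
        add_zero] at h2
      push_cast
      rw [← add_assoc, ← add_assoc]
      linarith
  refine le_of_forall_pos_le_add fun δ hδ => ?_
  obtain ⟨N, h1, h2⟩ := ((tendsto_deriv_logDeriv_Gamma (by linarith : 0 < s.re) hδ).and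
    (tendsto_natCast_atTop_atTop.eventually_ge_atTop |s.im|)).exists
  have h3 := (Complex.re_le_norm _).trans h1
  have hsq : s.im ^ 2 ≤ (s.re + N) ^ 2 := by
    rw [← sq_abs s.im]
    exact pow_le_pow_left₀ (abs_nonneg _) (by linarith) 2
  have hN : (0 : ℝ) ≤ N := N.cast_nonneg
  have h4 : 0 ≤ trigammaMajorant (s.re + N) s.im := by
    unfold trigammaMajorant
    have := sub_nonneg.2 hsq
    have : 0 ≤ s.re + N := by linarith
    positivity
  linarith [hstep N]

theorem trigammaMajorant_quarter_le {b : ℝ} (hb : b ≠ 0) :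
    trigammaMajorant (1 / 4) b ≤ 1 / b ^ 2 := by
  have hb2 : 0 < b ^ 2 := by positivity
  have hid : 1 / b ^ 2 - trigammaMajorant (1 / 4) b =
      (((1 / 4) ^ 2 + b ^ 2) ^ 2 - b ^ 2 * (((1 / 4) ^ 2 + b ^ 2) / 12 + 1 / 16)) /
        (b ^ 2 * ((1 / 4) ^ 2 + b ^ 2) ^ 2) := by
    unfold trigammaMajorant
    field_simp
    ring
  have h0 : 0 ≤ ((1 / 4) ^ 2 + b ^ 2) ^ 2 - b ^ 2 * (((1 / 4) ^ 2 + b ^ 2) / 12 + 1 / 16) := by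
    nlinarith [sq_nonneg (b ^ 2 - 1 / 32)]
  have := div_nonneg h0 (by positivity : 0 ≤ b ^ 2 * ((1 / 4) ^ 2 + b ^ 2) ^ 2)
  linarith

open scoped ComplexConjugate

/-- The Riemann `ξ`-function on the critical line, normalised as
`s (1 - s) Λ(s)` with `s = 1/2 + i z`. -/
noncomputable def xiLine (z : ℂ) : ℂ :=
  (1 / 4 + z ^ 2) * completedRiemannZeta₀ (1 / 2 + I * z) - 1

theorem differentiable_xiLine : Differentiable ℂ xiLine := by
  have h : Differentiable ℂ fun z : ℂ => completedRiemannZeta₀ (1 / 2 + I * z) :=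
    differentiable_completedZeta₀.comp (by fun_prop)
  unfold xiLine
  fun_prop

theorem quarter_add_sq_eq (z : ℂ) : 1 / 4 + z ^ 2 = (1 / 2 + I * z) * (1 - (1 / 2 + I * z)) := by
  linear_combination (z ^ 2) * I_sq

theorem xiLine_eq {z : ℂ} (hz : 1 / 4 + z ^ 2 ≠ 0) :
    xiLine z = (1 / 4 + z ^ 2) * completedRiemannZeta (1 / 2 + I * z) := by
  rw [xiLine, completedRiemannZeta_eq]
  rw [quarter_add_sq_eq] at hz ⊢
  have h1 := left_ne_zero_of_mul hz
  have h2 := right_ne_zero_of_mul hz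
  generalize 1 / 2 + I * z = s at h1 h2 ⊢
  field_simp
  ring

theorem im_eq_zero_of_xiLine_eq_zero (hRH : RiemannHypothesis) {z : ℂ} (h : xiLine z = 0) :
    z.im = 0 := by
  have hz : 1 / 4 + z ^ 2 ≠ 0 := by
    intro h0
    rw [xiLine, h0] at h
    simp at h
  rw [xiLine_eq hz] at h
  have hΛ := (mul_eq_zero.1 h).resolve_left hz
  rw [quarter_add_sq_eq] at hz
  set s : ℂ := 1 / 2 + I * z with hs
  have hs0 : s ≠ 0 := left_ne_zero_of_mul hz
  have hs1 : s ≠ 1 := fun h1 => right_ne_zero_of_mul hz (by rw [h1, sub_self])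
  have hζ : riemannZeta s = 0 := by rw [riemannZeta_def_of_ne_zero hs0, hΛ, zero_div]
  have hre := hRH s hζ (by
    rintro ⟨n, hn⟩
    have h1 : 1 < (1 - s).re := by
      rw [hn]
      simp
      positivity
    have h2 : 1 - s ≠ 0 := by
      intro h3
      rw [h3] at h1
      simp at h1
      linarith
    have h4 := riemannZeta_ne_zero_of_one_le_re h1.le
    rw [riemannZeta_def_of_ne_zero h2, completedRiemannZeta_one_sub, hΛ, zero_div] at h4
    exact h4 rfl) hs1
  simp [hs] at hre
  exact hre

theorem Gammaℝ_conj (s : ℂ) : Gammaℝ (conj s) = conj (Gammaℝ s) := by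
  have hpi : (Real.pi : ℂ).arg ≠ Real.pi := by
    rw [Complex.arg_ofReal_of_nonneg Real.pi_pos.le]
    exact Real.pi_pos.ne
  rw [Gammaℝ_def, Gammaℝ_def, map_mul, ← Complex.Gamma_conj]
  congr 1
  · have := Complex.cpow_conj (Real.pi : ℂ) (-s / 2) hpi
    simpa [Complex.conj_ofNat] using this
  · simp [Complex.conj_ofNat]

theorem quarter_add_sq_ne_zero (t : ℝ) : (1 / 4 + (t : ℂ) ^ 2) ≠ 0 := by
  have : (0 : ℝ) < 1 / 4 + t ^ 2 := by positivity
  intro h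
  refine this.ne' ?_
  have h' : ((1 / 4 + t ^ 2 : ℝ) : ℂ) = 0 := by
    push_cast
    exact h
  exact_mod_cast h'

theorem completedRiemannZeta_critical_conj (t : ℝ) :
    conj (completedRiemannZeta (1 / 2 + I * t)) = completedRiemannZeta (1 / 2 + I * t) := by
  set s : ℂ := 1 / 2 + I * t with hs
  have hsre : s.re = 1 / 2 := by simp [hs]
  have hs0 : s ≠ 0 := fun h => by simp [h] at hsre
  have hc : conj s = 1 - s := by
    apply Complex.ext
    · simp [hs]; norm_num
    · simp [hs]
  have hc0 : conj s ≠ 0 := by simpa using hs0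
  have hG : ∀ w : ℂ, w.re = 1 / 2 → w ≠ 0 → completedRiemannZeta w = riemannZeta w * Gammaℝ w := by
    intro w hw hw0
    rw [riemannZeta_def_of_ne_zero hw0, div_mul_cancel₀]
    exact Gammaℝ_ne_zero_of_re_pos (by rw [hw]; norm_num)
  rw [hG s hsre hs0, map_mul, ← riemannZeta_conj, ← Gammaℝ_conj,
    ← hG _ (by simpa using hsre) hc0, hc, completedRiemannZeta_one_sub, hG s hsre hs0]

theorem xiLine_im (t : ℝ) : (xiLine t).im = 0 := by
  rw [xiLine_eq (quarter_add_sq_ne_zero t), ← Complex.conj_eq_iff_im, map_mul,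
    completedRiemannZeta_critical_conj]
  simp [Complex.conj_ofNat]

theorem exists_norm_completedRiemannZeta₀_le_of_re_mem (A : ℝ) :
    ∃ B : ℝ, ∀ s : ℂ, |s.re| ≤ A → ‖completedRiemannZeta₀ s‖ ≤ B := by
  set P := (HurwitzZeta.hurwitzEvenFEPair 0) with hP
  have hconv : ∀ w : ℂ, MellinConvergent P.f_modif w := fun w =>
    (P.isStrongFEPair_toStrongFEPair.hasMellin w).1
  have hI : ∀ σ : ℝ, MeasureTheory.IntegrableOn
      (fun t : ℝ => t ^ (σ - 1) * ‖P.f_modif t‖) (Set.Ioi 0) := by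
    intro σ
    have h : MeasureTheory.IntegrableOn
        (fun t : ℝ => ‖(t : ℂ) ^ ((σ : ℂ) - 1) • P.f_modif t‖) (Set.Ioi 0) :=
      MeasureTheory.Integrable.norm (hconv σ)
    refine h.congr_fun (fun t ht => ?_) measurableSet_Ioi
    simp only [norm_smul, Complex.norm_cpow_eq_rpow_re_of_pos ht]
    simp
  refine ⟨((∫ t in Set.Ioi (0 : ℝ), t ^ (A / 2 - 1) * ‖P.f_modif t‖) +
    ∫ t in Set.Ioi (0 : ℝ), t ^ (-A / 2 - 1) * ‖P.f_modif t‖) / 2, fun s hs => ?_⟩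
  have hdef : completedRiemannZeta₀ s = mellin P.f_modif (s / 2) / 2 := rfl
  rw [hdef, norm_div, Complex.norm_ofNat]
  gcongr
  rw [mellin, ← MeasureTheory.integral_add (hI _) (hI _)]
  refine (MeasureTheory.norm_integral_le_integral_norm _).trans ?_
  refine MeasureTheory.setIntegral_mono_on (MeasureTheory.Integrable.norm (hconv _))
    ((hI _).add (hI _)) measurableSet_Ioi fun t ht => ?_
  have ht0 : (0 : ℝ) < t := ht
  rw [norm_smul, Complex.norm_cpow_eq_rpow_re_of_pos ht0, ← add_mul]
  refine mul_le_mul_of_nonneg_right ?_ (norm_nonneg _)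
  have hre : (s / 2 - 1).re = s.re / 2 - 1 := by simp
  rw [hre]
  obtain ⟨h1, h2⟩ := abs_le.1 hs
  rcases le_total 1 t with h | h
  · have := Real.rpow_le_rpow_of_exponent_le h (by linarith : s.re / 2 - 1 ≤ A / 2 - 1)
    have := Real.rpow_nonneg ht0.le (-A / 2 - 1)
    linarith
  · have := Real.rpow_le_rpow_of_exponent_ge ht0 h (by linarith : -A / 2 - 1 ≤ s.re / 2 - 1)
    have := Real.rpow_nonneg ht0.le (A / 2 - 1)
    linarith

theorem exists_norm_riemannZeta_le : ∃ C : ℝ, ∀ s : ℂ, 2 ≤ s.re → ‖riemannZeta s‖ ≤ C := by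
  have hsum : Summable fun n : ℕ => 1 / ((n : ℝ) + 1) ^ 2 := by
    have := (summable_nat_add_iff 1).2 (Real.summable_one_div_nat_pow.2 (by norm_num : 1 < 2))
    simpa using this
  refine ⟨∑' n : ℕ, 1 / ((n : ℝ) + 1) ^ 2, fun s hs => ?_⟩
  rw [zeta_eq_tsum_one_div_nat_add_one_cpow (by linarith)]
  refine tsum_of_norm_bounded hsum.hasSum fun n => ?_
  have h1 : (0 : ℝ) < (n : ℝ) + 1 := by positivity
  have h2 : ‖((n : ℂ) + 1) ^ s‖ = ((n : ℝ) + 1) ^ s.re := by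
    rw [← Complex.norm_cpow_eq_rpow_re_of_pos h1]
    push_cast
    rfl
  rw [norm_div, norm_one, h2]
  gcongr
  rw [← Real.rpow_natCast]
  exact Real.rpow_le_rpow_of_exponent_le (by linarith [(n.cast_nonneg : (0 : ℝ) ≤ n)])
    (by exact_mod_cast hs)

theorem exists_norm_completedRiemannZeta₀_le_factorial :
    ∃ C : ℝ, ∀ (n : ℕ) (s : ℂ), ‖s‖ ≤ n →
      ‖completedRiemannZeta₀ s‖ ≤ C * (n + 1).factorial := by
  obtain ⟨B, hB⟩ := exists_norm_completedRiemannZeta₀_le_of_re_mem 4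
  obtain ⟨C, hC⟩ := exists_norm_riemannZeta_le
  have hB0 : 0 ≤ B := (norm_nonneg _).trans (hB 0 (by simp))
  have hC0 : 0 ≤ C := (norm_nonneg _).trans (hC 2 (by simp))
  have hright : ∀ (n : ℕ) (s : ℂ), 4 ≤ s.re → ‖s‖ ≤ n →
      ‖completedRiemannZeta₀ s‖ ≤ (C + 2) * n.factorial := by
    intro n s hs hn
    have hs0 : s ≠ 0 := by
      rintro rfl
      simp at hs
      linarith
    have hG : completedRiemannZeta s = riemannZeta s * Gammaℝ s := by
      rw [riemannZeta_def_of_ne_zero hs0, div_mul_cancel₀]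
      exact Gammaℝ_ne_zero_of_re_pos (by linarith)
    have hGb : ‖Gammaℝ s‖ ≤ n.factorial := by
      rw [Gammaℝ_def, norm_mul, Complex.norm_cpow_eq_rpow_re_of_pos Real.pi_pos]
      have h1 : Real.pi ^ (-s / 2).re ≤ 1 :=
        Real.rpow_le_one_of_one_le_of_nonpos (by linarith [Real.pi_gt_three])
          (by simp; linarith)
      have h2 : ‖Complex.Gamma (s / 2)‖ ≤ n.factorial := by
        have := (Complex.re_le_norm s).trans hn
        exact norm_Gamma_le_factorial (by simp; linarith) (by simp; linarith)
      calc _ ≤ 1 * (n.factorial : ℝ) := mul_le_mul h1 h2 (norm_nonneg _) zero_le_one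
        _ = _ := one_mul _
    have hfac : (1 : ℝ) ≤ n.factorial := by exact_mod_cast Nat.factorial_pos n
    have heq : completedRiemannZeta₀ s = completedRiemannZeta s + 1 / s + 1 / (1 - s) := by
      rw [completedRiemannZeta_eq]
      ring
    have h1 : ‖1 / s‖ ≤ 1 := by
      rw [norm_div, norm_one]
      exact div_le_one_of_le₀ (by linarith [Complex.re_le_norm s]) (norm_nonneg _)
    have h2 : ‖1 / (1 - s)‖ ≤ 1 := by
      rw [norm_div, norm_one]
      refine div_le_one_of_le₀ ?_ (norm_nonneg _)
      rw [norm_sub_rev]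
      have := Complex.re_le_norm (s - 1)
      simp at this
      linarith
    rw [heq, hG]
    have h3 : ‖riemannZeta s * Gammaℝ s‖ ≤ C * n.factorial := by
      rw [norm_mul]
      exact mul_le_mul (hC s (by linarith)) hGb (norm_nonneg _) hC0
    have h4 := norm_add₃_le (a := riemannZeta s * Gammaℝ s) (b := 1 / s) (c := 1 / (1 - s))
    nlinarith
  refine ⟨C + 2 + B, fun n s hn => ?_⟩
  have hfac : (n.factorial : ℝ) ≤ (n + 1).factorial := by
    exact_mod_cast Nat.factorial_le (Nat.le_succ n)
  have hfac1 : (1 : ℝ) ≤ n.factorial := by exact_mod_cast Nat.factorial_pos n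
  rcases le_or_gt |s.re| 4 with h | h
  · refine (hB s h).trans ?_
    nlinarith
  rcases lt_abs.1 h with h | h
  · refine (hright n s h.le hn).trans ?_
    nlinarith
  · rw [← completedRiemannZeta₀_one_sub]
    have h1 : ‖1 - s‖ ≤ ((n + 1 : ℕ) : ℝ) := by
      have := norm_sub_le 1 s
      rw [norm_one] at this
      push_cast
      linarith
    refine (hright (n + 1) (1 - s) (by simp; linarith) h1).trans ?_
    nlinarith

theorem eventually_polynomial_le_exp {C ε : ℝ} (hC0 : 0 ≤ C) (hε : 0 < ε) :
    ∀ᶠ r : ℝ in atTop, (1 + r ^ 2) * C + 1 ≤ Real.exp (ε / 2 * r ^ 2) := by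
  have hy : Tendsto (fun r : ℝ => ε / 2 * r ^ 2) atTop atTop :=
    (tendsto_pow_atTop two_ne_zero).const_mul_atTop (by positivity)
  have h1 := hy.eventually ((Real.tendsto_exp_div_pow_atTop 1).eventually_ge_atTop
    (2 / ε * C * 2 + 1))
  filter_upwards [h1, hy.eventually_ge_atTop 1, eventually_ge_atTop (1 : ℝ)] with r h2 h3 h4
  rw [pow_one, le_div_iff₀ (by linarith)] at h2
  refine le_trans ?_ h2
  have h5 : (2 / ε * C * 2 + 1) * (ε / 2 * r ^ 2) = 2 * C * r ^ 2 + ε / 2 * r ^ 2 := by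
    field_simp
  rw [h5]
  nlinarith [mul_nonneg hC0 (by nlinarith : 0 ≤ r ^ 2 - 1)]

theorem xiLine_growth {ε : ℝ} (hε : 0 < ε) :
    ∀ᶠ z in Bornology.cobounded ℂ, ‖xiLine z‖ ≤ Real.exp (ε * ‖z‖ ^ 2) := by
  obtain ⟨C, hC⟩ := exists_norm_completedRiemannZeta₀_le_factorial
  have hC0 : 0 ≤ C := by
    have := (norm_nonneg _).trans (hC 0 0 (by simp))
    simpa using this
  have hnorm : Tendsto (fun z : ℂ => ‖z‖) (Bornology.cobounded ℂ) atTop :=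
    tendsto_norm_cobounded_atTop
  have hceil : Tendsto (fun z : ℂ => ⌈‖z‖⌉₊ + 1 + 1) (Bornology.cobounded ℂ) atTop :=
    tendsto_atTop_mono (fun z => Nat.le_add_right _ 2) (tendsto_nat_ceil_atTop.comp hnorm)
  filter_upwards [hceil.eventually (eventually_factorial_le_exp (by positivity : 0 < ε / 8)),
    hnorm.eventually (eventually_polynomial_le_exp hC0 hε),
    hnorm.eventually_ge_atTop 3] with z h1 h2 h3
  have hs : ‖1 / 2 + I * z‖ ≤ ((⌈‖z‖⌉₊ + 1 : ℕ) : ℝ) := by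
    have h4 := norm_add_le (1 / 2 : ℂ) (I * z)
    have h5 := Nat.le_ceil ‖z‖
    have h6 : ‖(1 / 2 : ℂ)‖ ≤ 1 := by norm_num
    rw [norm_mul, Complex.norm_I, one_mul] at h4
    push_cast
    linarith
  have hΛ : ‖completedRiemannZeta₀ (1 / 2 + I * z)‖ ≤ C * Real.exp (ε / 2 * ‖z‖ ^ 2) := by
    refine (hC _ _ hs).trans (mul_le_mul_of_nonneg_left (h1.trans (Real.exp_le_exp.2 ?_)) hC0)
    have h5 := (Nat.ceil_lt_add_one (norm_nonneg z)).le
    have h6 : ((⌈‖z‖⌉₊ + 1 + 1 : ℕ) : ℝ) ≤ 2 * ‖z‖ := by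
      push_cast
      linarith
    have h7 := pow_le_pow_left₀ (Nat.cast_nonneg _) h6 2
    nlinarith
  have hq : ‖1 / 4 + z ^ 2‖ ≤ 1 + ‖z‖ ^ 2 := by
    have h4 := norm_add_le (1 / 4 : ℂ) (z ^ 2)
    have h6 : ‖(1 / 4 : ℂ)‖ ≤ 1 := by norm_num
    rw [norm_pow] at h4
    linarith
  have hE : 1 ≤ Real.exp (ε / 2 * ‖z‖ ^ 2) := Real.one_le_exp (by positivity)
  calc ‖xiLine z‖ ≤ ‖(1 / 4 + z ^ 2) * completedRiemannZeta₀ (1 / 2 + I * z)‖ + ‖(1 : ℂ)‖ :=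
        norm_sub_le _ _
    _ ≤ (1 + ‖z‖ ^ 2) * (C * Real.exp (ε / 2 * ‖z‖ ^ 2)) + 1 := by
        rw [norm_mul, norm_one]
        gcongr
    _ ≤ ((1 + ‖z‖ ^ 2) * C + 1) * Real.exp (ε / 2 * ‖z‖ ^ 2) := by nlinarith
    _ ≤ Real.exp (ε / 2 * ‖z‖ ^ 2) * Real.exp (ε / 2 * ‖z‖ ^ 2) := by gcongr
    _ = Real.exp (ε * ‖z‖ ^ 2) := by
        rw [← Real.exp_add]
        ring_nf

theorem exp_RStheta_sq (t : ℝ) :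
    Complex.exp (I * RStheta t) ^ 2 =
      Gamma (1 / 4 + I * t / 2) / Gamma (1 / 4 - I * t / 2) *
        Complex.exp (-(I * t * Real.log Real.pi)) := by
  have hc : (1 / 4 - I * t / 2 : ℂ) = conj (1 / 4 + I * t / 2) := by
    simp [Complex.conj_ofNat]
    ring
  have hg : Gamma (1 / 4 + I * t / 2) ≠ 0 := Gamma_ne_zero_of_re_pos (by simp)
  have hw : ‖Gamma (1 / 4 + I * t / 2) / Gamma (1 / 4 - I * t / 2)‖ = 1 := by
    rw [hc, Complex.Gamma_conj, norm_div, RCLike.norm_conj, div_self (norm_ne_zero_iff.2 hg)]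
  have hw0 : Gamma (1 / 4 + I * t / 2) / Gamma (1 / 4 - I * t / 2) ≠ 0 := by
    rw [← norm_ne_zero_iff, hw]
    exact one_ne_zero
  rw [RStheta]
  generalize Gamma (1 / 4 + I * t / 2) / Gamma (1 / 4 - I * t / 2) = w at hw hw0
  have hlog : Complex.log w = arg w * I := by
    rw [Complex.log, hw, Real.log_one]
    simp
  have hre : (1 / (2 * I) * Complex.log w).re = arg w / 2 := by
    have h : 1 / (2 * I) * Complex.log w = ((arg w / 2 : ℝ) : ℂ) := by
      rw [hlog]
      push_cast
      field_simp
    rw [h, ofReal_re]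
  rw [hre, ← Complex.exp_nat_mul]
  have h : ((2 : ℕ) : ℂ) * (I * ((arg w / 2 - t / 2 * Real.log Real.pi : ℝ) : ℂ)) =
      Complex.log w + -(I * t * Real.log Real.pi) := by
    rw [hlog]
    push_cast
    ring
  rw [h, Complex.exp_add, Complex.exp_log hw0]

/-- The product of `Γ`-factors whose value at a real point `t` is `|Γ(1/4 + i t / 2)|²`. -/
noncomputable def gammaProd (z : ℂ) : ℂ := Gamma (1 / 4 + I * z / 2) * Gamma (1 / 4 - I * z / 2)

theorem gammaProd_ofReal (t : ℝ) :
    gammaProd t = ((normSq (Gamma (1 / 4 + I * t / 2)) : ℝ) : ℂ) := by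
  have hc : (1 / 4 - I * t / 2 : ℂ) = conj (1 / 4 + I * t / 2) := by
    simp [Complex.conj_ofNat]
    ring
  rw [gammaProd, hc, Complex.Gamma_conj, mul_conj]

theorem re_sq_of_sq_eq {z : ℂ} {r : ℝ} (hr : 0 ≤ r) (h : z ^ 2 = r) : z.re ^ 2 = r := by
  have h1 := congrArg re h
  have h2 := congrArg im h
  simp only [pow_two, mul_re, mul_im, ofReal_re, ofReal_im] at h1 h2
  rw [pow_two]
  rcases mul_eq_zero.1 (by linarith : z.re * z.im = 0) with h2 | h2
  · rw [h2] at h1 ⊢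
    nlinarith [mul_self_nonneg z.im]
  · rw [h2] at h1
    nlinarith

theorem HardyZ_sq (t : ℝ) :
    ((HardyZ t ^ 2 : ℝ) : ℂ) =
      Real.sqrt Real.pi * xiLine t ^ 2 / ((1 / 4 + (t : ℂ) ^ 2) ^ 2 * gammaProd t) := by
  have hq := quarter_add_sq_ne_zero t
  have hre : (1 / 2 + I * t : ℂ).re = 1 / 2 := by simp
  have hs0 : (1 / 2 + I * t : ℂ) ≠ 0 := fun h => by norm_num [h] at hre
  have hg : Gamma (1 / 4 + I * t / 2) ≠ 0 := Gamma_ne_zero_of_re_pos (by simp)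
  have hg' : Gamma (1 / 4 - I * t / 2) ≠ 0 := Gamma_ne_zero_of_re_pos (by simp)
  have hpi : (Real.pi : ℂ) ≠ 0 := by exact_mod_cast Real.pi_ne_zero
  have hz : (Complex.exp (I * RStheta t) * riemannZeta (1 / 2 + I * t)) ^ 2 =
      Real.sqrt Real.pi * xiLine t ^ 2 / ((1 / 4 + (t : ℂ) ^ 2) ^ 2 * gammaProd t) := by
    have he : (Real.pi : ℂ) ^ (-(1 / 2 + I * t) / 2) ≠ 0 := by simp [Complex.cpow_eq_zero_iff, hpi]
    have hexp : Complex.exp (-(I * t * Real.log Real.pi)) =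
        Real.sqrt Real.pi * ((Real.pi : ℂ) ^ (-(1 / 2 + I * t) / 2)) ^ 2 := by
      rw [Complex.cpow_def_of_ne_zero hpi, ← Complex.exp_nat_mul, ← ofReal_log Real.pi_pos.le,
        Real.sqrt_eq_rpow, Real.rpow_def_of_pos Real.pi_pos, ofReal_exp, ← Complex.exp_add]
      congr 1
      push_cast
      ring
    have harg : (1 / 2 + I * t : ℂ) / 2 = 1 / 4 + I * t / 2 := by ring
    rw [mul_pow, exp_RStheta_sq, hexp, riemannZeta_def_of_ne_zero hs0, Gammaℝ_def, harg,
      xiLine_eq hq, gammaProd]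
    generalize (1 / 4 + (t : ℂ) ^ 2) = q at hq ⊢
    generalize Gamma (1 / 4 + I * t / 2) = g at hg ⊢
    generalize Gamma (1 / 4 - I * t / 2) = g' at hg' ⊢
    field_simp
  have hX : xiLine t = ((xiLine t).re : ℂ) := by
    rw [← Complex.conj_eq_iff_re.1 (Complex.conj_eq_iff_im.2 (xiLine_im t))]
    simp
  have hr : (Real.sqrt Real.pi * xiLine t ^ 2 / ((1 / 4 + (t : ℂ) ^ 2) ^ 2 * gammaProd t)) =
      ((Real.sqrt Real.pi * (xiLine t).re ^ 2 /
        ((1 / 4 + t ^ 2) ^ 2 * normSq (Gamma (1 / 4 + I * t / 2))) : ℝ) : ℂ) := by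
    rw [gammaProd_ofReal, hX]
    push_cast
    simp
  rw [hr] at hz ⊢
  rw [HardyZ, re_sq_of_sq_eq _ hz]
  exact div_nonneg (by positivity) (mul_nonneg (by positivity) (normSq_nonneg _))

theorem gammaProd_ne_zero (t : ℝ) : gammaProd t ≠ 0 :=
  mul_ne_zero (Gamma_ne_zero_of_re_pos (by simp)) (Gamma_ne_zero_of_re_pos (by simp))

theorem HardyZ_eq_zero_iff (t : ℝ) : HardyZ t = 0 ↔ xiLine t = 0 := by
  have h := HardyZ_sq t
  have hpi : ((Real.sqrt Real.pi : ℝ) : ℂ) ≠ 0 := by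
    exact_mod_cast (Real.sqrt_pos.2 Real.pi_pos).ne'
  have hd : (1 / 4 + (t : ℂ) ^ 2) ^ 2 * gammaProd t ≠ 0 :=
    mul_ne_zero (pow_ne_zero _ (quarter_add_sq_ne_zero t)) (gammaProd_ne_zero t)
  constructor
  · intro h0
    rw [h0] at h
    have h1 : Real.sqrt Real.pi * xiLine t ^ 2 / ((1 / 4 + (t : ℂ) ^ 2) ^ 2 * gammaProd t) = 0 := by
      rw [← h]
      simp
    exact pow_eq_zero_iff two_ne_zero |>.1
      ((mul_eq_zero.1 ((div_eq_zero_iff.1 h1).resolve_right hd)).resolve_left hpi)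
  · intro h0
    rw [h0] at h
    have : HardyZ t ^ 2 = 0 := by
      have : ((HardyZ t ^ 2 : ℝ) : ℂ) = 0 := by rw [h]; simp
      exact_mod_cast this
    exact pow_eq_zero_iff two_ne_zero |>.1 this

theorem deriv_logDeriv_eq {u : ℝ → ℝ} {x : ℝ} (hu : AnalyticAt ℝ u x) (h0 : u x ≠ 0) :
    deriv (logDeriv u) x = (deriv (deriv u) x * u x - deriv u x ^ 2) / u x ^ 2 := by
  have h := hu.deriv.differentiableAt.hasDerivAt.div hu.differentiableAt.hasDerivAt h0
  rw [pow_two (deriv u x)]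
  exact h.deriv

/-- The combination of derivatives in `Fhat` at a simple zero, in terms of the cofactor. -/
theorem schwarzian_at_zero {h u : ℝ → ℝ} {x : ℝ} (hu : AnalyticAt ℝ u x) (h0 : u x ≠ 0)
    (hh : h =ᶠ[𝓝 x] fun t => (t - x) * u t) :
    -(iteratedDeriv 3 h x / deriv h x) + 3 / 4 * (iteratedDeriv 2 h x / deriv h x) ^ 2 =
      -3 * deriv (logDeriv u) x := by
  have hid : ∀ t, HasDerivAt (fun t : ℝ => t - x) 1 t := fun t => (hasDerivAt_id t).sub_const x
  have h1 : deriv h =ᶠ[𝓝 x] fun t => u t + (t - x) * deriv u t := by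
    refine hh.deriv.trans ?_
    filter_upwards [hu.eventually_analyticAt] with t ht
    refine ((hid t).fun_mul ht.differentiableAt.hasDerivAt).deriv.trans ?_
    rw [one_mul]
  have h2 : deriv (deriv h) =ᶠ[𝓝 x] fun t => 2 * deriv u t + (t - x) * deriv (deriv u) t := by
    refine h1.deriv.trans ?_
    filter_upwards [hu.eventually_analyticAt] with t ht
    refine (ht.differentiableAt.hasDerivAt.fun_add
      ((hid t).fun_mul ht.deriv.differentiableAt.hasDerivAt)).deriv.trans ?_
    ring
  have h3 : deriv (deriv (deriv h)) x = 3 * deriv (deriv u) x := by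
    rw [h2.deriv_eq]
    refine ((hu.deriv.differentiableAt.hasDerivAt.const_mul 2).fun_add
      ((hid x).fun_mul hu.deriv.deriv.differentiableAt.hasDerivAt)).deriv.trans ?_
    ring
  simp only [iteratedDeriv_succ, iteratedDeriv_zero]
  rw [h3, h1.eq_of_nhds, h2.eq_of_nhds, deriv_logDeriv_eq hu h0, sub_self, zero_mul,
    zero_mul, add_zero, add_zero]
  field_simp
  ring

theorem deriv_logDeriv_re {Q : ℂ → ℂ} {x : ℝ} (hQ : AnalyticAt ℂ Q x) (h0 : Q x ≠ 0)
    (hreal : ∀ t : ℝ, (Q t).im = 0) :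
    deriv (logDeriv fun t : ℝ => (Q t).re) x = (deriv (logDeriv Q) x).re := by
  have hcont : Tendsto (fun t : ℝ => (t : ℂ)) (𝓝 x) (𝓝 (x : ℂ)) :=
    Complex.continuous_ofReal.continuousAt
  have h : (logDeriv fun t : ℝ => (Q t).re) =ᶠ[𝓝 x] fun t => (logDeriv Q t).re := by
    filter_upwards [hcont.eventually hQ.eventually_analyticAt] with t ht
    rw [logDeriv_apply, logDeriv_apply, ht.differentiableAt.hasDerivAt.real_of_complex.deriv]
    have h1 : Q t = ((Q t).re : ℂ) := Complex.ext rfl (by simp [hreal])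
    rw [h1, Complex.div_ofReal_re, ofReal_re]
  rw [h.deriv_eq]
  have hL : DifferentiableAt ℂ (logDeriv Q) x :=
    hQ.deriv.differentiableAt.div hQ.differentiableAt h0
  exact hL.hasDerivAt.real_of_complex.deriv

/-- If `h ^ 2` has the analytic cofactor `Q` at a simple zero of `h`, then the combination of
derivatives in `Fhat` is controlled by the second logarithmic derivative of `Q`. -/
theorem schwarzian_at_zero_of_sq {h : ℝ → ℝ} {Q : ℂ → ℂ} {x : ℝ} (hx : h x = 0)
    (hd : deriv h x ≠ 0) (hQ : AnalyticAt ℂ Q x)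
    (hsq : ∀ t : ℝ, ((h t ^ 2 : ℝ) : ℂ) = (t - x) ^ 2 * Q t) :
    Q x ≠ 0 ∧
    -(iteratedDeriv 3 h x / deriv h x) + 3 / 4 * (iteratedDeriv 2 h x / deriv h x) ^ 2 =
      -(3 / 2) * (deriv (logDeriv Q) x).re := by
  set u := dslope h x with hu
  have hux : u x ≠ 0 := by rwa [hu, dslope_same]
  have hhu : ∀ t, h t = (t - x) * u t := fun t => by
    have := sub_smul_dslope h x t
    rw [hx, sub_zero, smul_eq_mul] at this
    exact this.symm
  have huc : ContinuousAt u x := continuousAt_dslope_same.2 (differentiableAt_of_deriv_ne_zero hd)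
  have hcont : Tendsto (fun t : ℝ => (t : ℂ)) (𝓝 x) (𝓝 (x : ℂ)) :=
    Complex.continuous_ofReal.continuousAt
  have hne : ∀ t : ℝ, t ≠ x → Q t = ((u t ^ 2 : ℝ) : ℂ) := by
    intro t ht
    have h1 : ((t : ℂ) - x) ^ 2 ≠ 0 := by
      refine pow_ne_zero _ (sub_ne_zero.2 ?_)
      exact_mod_cast ht
    refine mul_left_cancel₀ h1 ?_
    rw [← hsq, hhu]
    push_cast
    ring
  have hQu : ∀ t : ℝ, Q t = ((u t ^ 2 : ℝ) : ℂ) := by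
    intro t
    rcases eq_or_ne t x with rfl | ht
    · have h1 : Tendsto (fun t : ℝ => Q t) (𝓝[≠] t) (𝓝 (Q t)) :=
        (hQ.continuousAt.tendsto.comp hcont).mono_left nhdsWithin_le_nhds
      have h2 : Tendsto (fun t : ℝ => ((u t ^ 2 : ℝ) : ℂ)) (𝓝[≠] t) (𝓝 ((u t ^ 2 : ℝ) : ℂ)) :=
        ((Complex.continuous_ofReal.tendsto _).comp (huc.pow 2)).mono_left nhdsWithin_le_nhds
      refine tendsto_nhds_unique (h1.congr' ?_) h2
      filter_upwards [self_mem_nhdsWithin] with s hs using hne s hs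
    · exact hne t ht
  have hQx : Q x ≠ 0 := by
    rw [hQu]
    exact_mod_cast pow_ne_zero 2 hux
  have hsign : ∃ σ : ℝ, σ ≠ 0 ∧ ∀ᶠ t in 𝓝 x, u t = σ * |u t| := by
    rcases lt_or_gt_of_ne hux with h | h
    · refine ⟨-1, by norm_num, ?_⟩
      filter_upwards [huc.eventually_lt_const h] with t ht
      rw [abs_of_neg ht]
      ring
    · refine ⟨1, one_ne_zero, ?_⟩
      filter_upwards [huc.eventually_const_lt h] with t ht
      rw [abs_of_pos ht, one_mul]
  obtain ⟨σ, hσ, hσu⟩ := hsign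
  set q : ℝ → ℝ := fun t => (Q t).re with hq
  have hqu : ∀ t, q t = u t ^ 2 := fun t => by rw [hq]; simp only [hQu, ofReal_re]
  have hqx : 0 < q x := by
    rw [hqu]
    positivity
  have hqa : AnalyticAt ℝ q x := by
    have h1 : AnalyticAt ℝ Q (x : ℂ) := hQ.restrictScalars
    exact (Complex.reCLM.analyticAt _).comp
      (h1.fun_comp (Complex.ofRealCLM.analyticAt x))
  set v : ℝ → ℝ := fun t => σ * Real.exp (1 / 2 * Real.log (q t)) with hv
  have hva : AnalyticAt ℝ v x :=
    analyticAt_const.mul ((analyticAt_const.mul (hqa.log hqx)).rexp')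
  have hvx : v x ≠ 0 := mul_ne_zero hσ (Real.exp_ne_zero _)
  have hqev : ∀ᶠ t in 𝓝 x, 0 < q t := hqa.continuousAt.eventually_const_lt hqx
  have hhv : h =ᶠ[𝓝 x] fun t => (t - x) * v t := by
    filter_upwards [hσu, hqev] with t h1 h2
    have h3 : u t ≠ 0 := by
      intro h4
      rw [hqu, h4] at h2
      norm_num at h2
    rw [hhu t, h1, hv]
    simp only [hqu, Real.log_pow]
    rw [← Real.log_abs, show 1 / 2 * ((2 : ℕ) * Real.log |u t|) = Real.log |u t| by
      push_cast; ring, Real.exp_log (abs_pos.2 h3)]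
  refine ⟨hQx, ?_⟩
  have hlog : logDeriv v =ᶠ[𝓝 x] fun t => 1 / 2 * logDeriv q t := by
    filter_upwards [hqev, hqa.eventually_analyticAt] with t h1 h2
    have h3 := ((h2.differentiableAt.hasDerivAt.log h1.ne').const_mul (1 / 2)).exp.const_mul σ
    rw [logDeriv_apply, h3.deriv, logDeriv_apply, hv]
    have := Real.exp_ne_zero (1 / 2 * Real.log (q t))
    field_simp
  have hqd : DifferentiableAt ℝ (logDeriv q) x :=
    hqa.deriv.differentiableAt.div hqa.differentiableAt hqx.ne'
  rw [schwarzian_at_zero hva hvx hhv, hlog.deriv_eq, (hqd.hasDerivAt.const_mul (1 / 2)).deriv,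
    deriv_logDeriv_re hQ hQx (fun t => by rw [hQu, ofReal_im])]
  ring

theorem deriv_logDeriv_comp_linear {f : ℂ → ℂ} {a b x : ℂ} (hf : AnalyticAt ℂ f (a * x + b))
    (h0 : f (a * x + b) ≠ 0) :
    deriv (logDeriv fun z => f (a * z + b)) x = a ^ 2 * deriv (logDeriv f) (a * x + b) := by
  have hlin : ∀ z : ℂ, HasDerivAt (fun z : ℂ => a * z + b) a z := fun z => by
    simpa using ((hasDerivAt_id z).const_mul a).add_const b
  have hev : logDeriv (fun z => f (a * z + b)) =ᶠ[𝓝 x] fun z => a * logDeriv f (a * z + b) := by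
    have hc : Tendsto (fun z : ℂ => a * z + b) (𝓝 x) (𝓝 (a * x + b)) :=
      (hlin x).continuousAt
    filter_upwards [hc.eventually hf.eventually_analyticAt] with z hz
    have h1 := hz.differentiableAt.hasDerivAt.comp z (hlin z)
    rw [logDeriv_apply, logDeriv_apply, ← Function.comp_def f fun z => a * z + b, h1.deriv]
    ring
  have hd : DifferentiableAt ℂ (logDeriv f) (a * x + b) :=
    hf.deriv.differentiableAt.div hf.differentiableAt h0
  rw [hev.deriv_eq]
  refine ((hd.hasDerivAt.comp x (hlin x)).const_mul a).deriv.trans ?_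
  ring

theorem re_deriv_logDeriv_gammaProd_ge {x : ℝ} (hx : x ≠ 0) :
    -(2 / x ^ 2) ≤ (deriv (logDeriv gammaProd) x).re := by
  have hfun : gammaProd = fun z : ℂ =>
      Gamma (I / 2 * z + 1 / 4) * Gamma (-I / 2 * z + 1 / 4) := by
    funext z
    simp only [gammaProd]
    congr 2 <;> ring
  have hr1 : (I / 2 * x + 1 / 4 : ℂ).re = 1 / 4 := by simp
  have hr2 : (-I / 2 * x + 1 / 4 : ℂ).re = 1 / 4 := by simp
  have hi1 : (I / 2 * x + 1 / 4 : ℂ).im = x / 2 := by simp; ring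
  have hi2 : (-I / 2 * x + 1 / 4 : ℂ).im = -x / 2 := by simp; ring
  have hp1 : 0 < (I / 2 * x + 1 / 4 : ℂ).re := by rw [hr1]; norm_num
  have hp2 : 0 < (-I / 2 * x + 1 / 4 : ℂ).re := by rw [hr2]; norm_num
  have ha1 := analyticAt_Gamma_of_re_pos hp1
  have ha2 := analyticAt_Gamma_of_re_pos hp2
  have hn1 := Gamma_ne_zero_of_re_pos hp1
  have hn2 := Gamma_ne_zero_of_re_pos hp2
  have hl : ∀ a : ℂ, AnalyticAt ℂ (fun z => a * z + 1 / 4) (x : ℂ) := fun a => by fun_prop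
  have hb1 := re_deriv_logDeriv_Gamma_le hr1.ge
  have hb2 := re_deriv_logDeriv_Gamma_le hr2.ge
  rw [hr1, hi1] at hb1
  rw [hr2, hi2] at hb2
  have hc1 := hb1.trans (trigammaMajorant_quarter_le (div_ne_zero hx two_ne_zero))
  have hc2 := hb2.trans (trigammaMajorant_quarter_le (div_ne_zero (neg_ne_zero.2 hx) two_ne_zero))
  rw [hfun, deriv_logDeriv_mul (f := fun z => Gamma (I / 2 * z + 1 / 4))
      (g := fun z => Gamma (-I / 2 * z + 1 / 4)) (ha1.fun_comp_of_eq (hl _) rfl)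
      (ha2.fun_comp_of_eq (hl _) rfl) hn1 hn2,
    deriv_logDeriv_comp_linear ha1 hn1, deriv_logDeriv_comp_linear ha2 hn2]
  have hI1 : (I / 2) ^ 2 = ((-(1 / 4) : ℝ) : ℂ) := by
    rw [div_pow, I_sq]
    norm_num
  have hI2 : (-I / 2) ^ 2 = ((-(1 / 4) : ℝ) : ℂ) := by
    rw [div_pow, neg_sq, I_sq]
    norm_num
  rw [hI1, hI2, add_re, re_ofReal_mul, re_ofReal_mul]
  have he1 : 1 / (x / 2) ^ 2 = 4 / x ^ 2 := by field_simp; norm_num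
  have he2 : 1 / (-x / 2) ^ 2 = 4 / x ^ 2 := by field_simp; norm_num
  have he3 : 4 / x ^ 2 = 2 * (2 / x ^ 2) := by ring
  rw [he1, he3] at hc1
  rw [he2, he3] at hc2
  linarith

theorem re_deriv_logDeriv_quarter_add_sq_ge {x : ℝ} (hx : x ≠ 0) :
    -(2 / x ^ 2) ≤ (deriv (logDeriv fun z : ℂ => 1 / 4 + z ^ 2) x).re := by
  have hd : ∀ z : ℂ, HasDerivAt (fun z : ℂ => 1 / 4 + z ^ 2) (2 * z) z := fun z => by
    simpa using ((hasDerivAt_id z).pow 2).const_add (1 / 4)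
  have hq := quarter_add_sq_ne_zero x
  have hl : logDeriv (fun z : ℂ => 1 / 4 + z ^ 2) = fun z => 2 * z / (1 / 4 + z ^ 2) := by
    funext z
    rw [logDeriv_apply, (hd z).deriv]
  have h2 : HasDerivAt (fun z : ℂ => 2 * z) 2 (x : ℂ) := by
    simpa using (hasDerivAt_id (x : ℂ)).const_mul 2
  rw [hl, (h2.fun_div (hd x) hq).deriv]
  have hr : ((2 * (1 / 4 + (x : ℂ) ^ 2) - 2 * x * (2 * x)) / (1 / 4 + (x : ℂ) ^ 2) ^ 2) =
      (((2 * (1 / 4 + x ^ 2) - 2 * x * (2 * x)) / (1 / 4 + x ^ 2) ^ 2 : ℝ) : ℂ) := by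
    push_cast
    rfl
  rw [hr, ofReal_re, ← neg_div, div_le_div_iff₀ (by positivity) (by positivity)]
  nlinarith [sq_nonneg x]

/-- The cofactor of `xiLine` at the point `γ`. -/
noncomputable def xiCofactor (γ : ℝ) : ℂ → ℂ := dslope xiLine γ

theorem differentiable_xiCofactor (γ : ℝ) : Differentiable ℂ (xiCofactor γ) := by
  rw [← differentiableOn_univ]
  exact (Complex.differentiableOn_dslope univ_mem).2 differentiable_xiLine.differentiableOn

theorem xiLine_eq_sub_mul {γ : ℝ} (h : xiLine γ = 0) (z : ℂ) :
    xiLine z = (z - γ) * xiCofactor γ z := by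
  have := sub_smul_dslope xiLine γ z
  rw [h, sub_zero, smul_eq_mul] at this
  exact this.symm

theorem xiCofactor_growth {γ : ℝ} (h : xiLine γ = 0) {ε : ℝ} (hε : 0 < ε) :
    ∀ᶠ z in Bornology.cobounded ℂ, ‖xiCofactor γ z‖ ≤ Real.exp (ε * ‖z‖ ^ 2) := by
  filter_upwards [xiLine_growth hε,
    tendsto_norm_cobounded_atTop.eventually_ge_atTop (1 + ‖(γ : ℂ)‖)] with z h1 h2
  refine le_trans ?_ h1
  rw [xiLine_eq_sub_mul h, norm_mul]
  have h3 := norm_sub_norm_le z (γ : ℂ)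
  exact le_mul_of_one_le_left (norm_nonneg _) (by linarith)

theorem Fhat_ge {γ : ℝ} (hγ : γ ≠ 0) (hs : IsSimpleZeroZ γ) :
    xiCofactor γ γ ≠ 0 ∧
      -3 * (deriv (logDeriv (xiCofactor γ)) γ).re - 9 / γ ^ 2 ≤ Fhat γ := by
  have hX := (HardyZ_eq_zero_iff γ).1 hs.1
  set U := xiCofactor γ with hU
  have hUa : AnalyticAt ℂ U γ := (differentiable_xiCofactor γ).analyticAt _
  have hq := quarter_add_sq_ne_zero γ
  have hqa : AnalyticAt ℂ (fun z : ℂ => 1 / 4 + z ^ 2) γ := by fun_prop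
  have hGa : AnalyticAt ℂ gammaProd γ := by
    refine AnalyticAt.mul ?_ ?_
    · exact (analyticAt_Gamma_of_re_pos (by simp)).fun_comp (by fun_prop)
    · exact (analyticAt_Gamma_of_re_pos (by simp)).fun_comp (by fun_prop)
  have hG := gammaProd_ne_zero γ
  have hpi : ((Real.sqrt Real.pi : ℝ) : ℂ) ≠ 0 := by
    exact_mod_cast (Real.sqrt_pos.2 Real.pi_pos).ne'
  set N : ℂ → ℂ := fun z => Real.sqrt Real.pi * U z ^ 2 with hN
  set D : ℂ → ℂ := fun z => (1 / 4 + z ^ 2) ^ 2 * gammaProd z with hD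
  have hNa : AnalyticAt ℂ N γ := analyticAt_const.mul (hUa.fun_pow 2)
  have hDa : AnalyticAt ℂ D γ := (hqa.fun_pow 2).mul hGa
  have hD0 : D γ ≠ 0 := mul_ne_zero (pow_ne_zero _ hq) hG
  obtain ⟨hQ0, hF⟩ := schwarzian_at_zero_of_sq (Q := fun z => N z * (D z)⁻¹) hs.1 hs.2
    (hNa.mul (hDa.fun_inv hD0)) (fun t => by
      rw [HardyZ_sq, xiLine_eq_sub_mul hX]
      simp only [hN, hD, hU]
      ring)
  have hN0 : N γ ≠ 0 := left_ne_zero_of_mul hQ0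
  have hU0 : U γ ≠ 0 := by
    have := right_ne_zero_of_mul hN0
    exact fun h => this (by rw [h]; simp)
  refine ⟨hU0, ?_⟩
  have hconst : deriv (logDeriv fun _ : ℂ => ((Real.sqrt Real.pi : ℝ) : ℂ)) γ = 0 := by
    rw [logDeriv_const]
    exact deriv_const _ _
  rw [deriv_logDeriv_mul hNa (hDa.fun_inv hD0) hN0 (inv_ne_zero hD0), deriv_logDeriv_inv hDa hD0,
    hN, deriv_logDeriv_mul analyticAt_const (hUa.fun_pow 2) hpi (pow_ne_zero _ hU0), hconst,
    deriv_logDeriv_pow hUa, hD, deriv_logDeriv_mul (hqa.fun_pow 2) hGa (pow_ne_zero _ hq) hG,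
    deriv_logDeriv_pow hqa] at hF
  simp only [zero_add, add_re, neg_re, Nat.cast_ofNat, mul_re, re_ofNat, im_ofNat, zero_mul,
    sub_zero] at hF
  have h1 := re_deriv_logDeriv_gammaProd_ge hγ
  have h2 := re_deriv_logDeriv_quarter_add_sq_ge hγ
  have h3 : 9 / γ ^ 2 = 9 / 2 * (2 / γ ^ 2) := by ring
  rw [Fhat, hF, h3]
  linarith

theorem sum_le_Fhat (hRH : RiemannHypothesis) {γ : ℝ} (hγ : γ ≠ 0) (hs : IsSimpleZeroZ γ)
    {S : Finset ℝ} (hS : ∀ ρ ∈ S, HardyZ ρ = 0 ∧ ρ ≠ γ) :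
    3 * ∑ ρ ∈ S, 1 / (γ - ρ) ^ 2 - 9 / γ ^ 2 ≤ Fhat γ := by
  have hX := (HardyZ_eq_zero_iff γ).1 hs.1
  obtain ⟨hU, hF⟩ := Fhat_ge hγ hs
  have hsum := sum_le_neg_deriv_logDeriv (differentiable_xiCofactor γ)
    (fun ε hε => xiCofactor_growth hX hε)
    (fun z hz => im_eq_zero_of_xiLine_eq_zero hRH (by rw [xiLine_eq_sub_mul hX, hz, mul_zero]))
    hU (S := S) (fun ρ hρ => by
      have h1 := (HardyZ_eq_zero_iff ρ).1 (hS ρ hρ).1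
      rw [xiLine_eq_sub_mul hX] at h1
      refine (mul_eq_zero.1 h1).resolve_left (sub_ne_zero.2 ?_)
      exact_mod_cast (hS ρ hρ).2)
  linarith

theorem sum_le_of_ghat (hRH : RiemannHypothesis) {γ₁ γ₂ : ℝ} (h₁ : γ₁ ≠ 0) (h₂ : γ₂ ≠ 0)
    (hne : γ₁ ≠ γ₂) (hs₁ : IsSimpleZeroZ γ₁) (hs₂ : IsSimpleZeroZ γ₂) {S : Finset ℝ}
    (hS : ∀ ρ ∈ S, HardyZ ρ = 0 ∧ ρ ≠ γ₁ ∧ ρ ≠ γ₂) :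
    (γ₁ - γ₂) ^ 2 * ∑ ρ ∈ S, (1 / (ρ - γ₁) ^ 2 + 1 / (ρ - γ₂) ^ 2) ≤
      ghat γ₁ γ₂ + 3 * (γ₁ - γ₂) ^ 2 * (1 / γ₁ ^ 2 + 1 / γ₂ ^ 2) := by
  classical
  have key : ∀ γ γ' : ℝ, γ ≠ 0 → γ ≠ γ' → IsSimpleZeroZ γ → HardyZ γ' = 0 → γ' ∉ S →
      (∀ ρ ∈ S, HardyZ ρ = 0 ∧ ρ ≠ γ) →
      3 * (1 / (γ - γ') ^ 2 + ∑ ρ ∈ S, 1 / (ρ - γ) ^ 2) - 9 / γ ^ 2 ≤ Fhat γ := by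
    intro γ γ' h0 hn hs hz hnot hS'
    have h := sum_le_Fhat hRH h0 hs (S := insert γ' S) (fun ρ hρ => by
      rcases Finset.mem_insert.1 hρ with rfl | hρ
      · exact ⟨hz, hn.symm⟩
      · exact hS' ρ hρ)
    rw [Finset.sum_insert hnot] at h
    have hsymm : ∑ ρ ∈ S, 1 / (ρ - γ) ^ 2 = ∑ ρ ∈ S, 1 / (γ - ρ) ^ 2 :=
      Finset.sum_congr rfl fun ρ _ => by rw [← neg_sub, neg_sq]
    rwa [hsymm]
  have k1 := key γ₁ γ₂ h₁ hne hs₁ hs₂.1 (fun h => (hS _ h).2.2 rfl)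
    fun ρ hρ => ⟨(hS ρ hρ).1, (hS ρ hρ).2.1⟩
  have k2 := key γ₂ γ₁ h₂ hne.symm hs₂ hs₁.1 (fun h => (hS _ h).2.1 rfl)
    fun ρ hρ => ⟨(hS ρ hρ).1, (hS ρ hρ).2.2⟩
  have hd : γ₁ - γ₂ ≠ 0 := sub_ne_zero.2 hne
  have hpos : 0 < (γ₁ - γ₂) ^ 2 := by positivity
  have hinv : (γ₁ - γ₂) ^ 2 * (1 / (γ₁ - γ₂) ^ 2) = 1 := mul_one_div_cancel hpos.ne'
  have hinv' : (1 : ℝ) / (γ₂ - γ₁) ^ 2 = 1 / (γ₁ - γ₂) ^ 2 := by rw [← neg_sub, neg_sq]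
  rw [hinv'] at k2
  have h := mul_le_mul_of_nonneg_left (add_le_add k1 k2) hpos.le
  rw [ghat, Finset.sum_add_distrib]
  have e1 : 9 / γ₁ ^ 2 = 9 * (1 / γ₁ ^ 2) := by ring
  have e2 : 9 / γ₂ ^ 2 = 9 * (1 / γ₂ ^ 2) := by ring
  rw [e1, e2] at h
  linear_combination (1 / 3) * h - 2 * hinv

/-- Under RH, if `{γ₋, γ₊}` is a pair of consecutive simple (positive) zeros of Hardy's
Z-function and `ĝ_{γ₋,γ₊} < 4/5 − 3(γ₊−γ₋)²(1/γ₋² + 1/γ₊²)`, then `{γ₋, γ₊}` is a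
Lehmer pair. -/
theorem lehmer_of_ghat_lt (hRH : RiemannHypothesis) (γm γp : ℝ)
    (h0 : 0 < γm) (hlt : γm < γp)
    (hs₁ : IsSimpleZeroZ γm) (hs₂ : IsSimpleZeroZ γp)
    (hconsec : ∀ t : ℝ, γm < t → t < γp → HardyZ t ≠ 0)
    (hg : ghat γm γp < 4 / 5 - 3 * (γp - γm) ^ 2 * (1 / γm ^ 2 + 1 / γp ^ 2)) :
    IsLehmerPair γm γp := by
  refine ⟨h0, hlt, hs₁, hs₂, hconsec, ?_⟩
  have hpos : 0 < (γm - γp) ^ 2 := by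
    have := sub_ne_zero.2 hlt.ne
    positivity
  have hbound : ∀ S : Finset ℝ, (∀ ρ ∈ S, HardyZ ρ = 0 ∧ ρ ≠ γm ∧ ρ ≠ γp) →
      (γm - γp) ^ 2 * ∑ ρ ∈ S, (1 / (ρ - γm) ^ 2 + 1 / (ρ - γp) ^ 2) ≤
        ghat γm γp + 3 * (γm - γp) ^ 2 * (1 / γm ^ 2 + 1 / γp ^ 2) := fun S hS =>
    sum_le_of_ghat hRH h0.ne' (h0.trans hlt).ne' hlt.ne hs₁ hs₂ hS
  have hsq : (γp - γm) ^ 2 = (γm - γp) ^ 2 := by ring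
  rw [hsq] at hg
  set B := ghat γm γp + 3 * (γm - γp) ^ 2 * (1 / γm ^ 2 + 1 / γp ^ 2) with hB
  have hB0 : 0 ≤ B := by simpa using hbound ∅ (by simp)
  have htsum : ∑' γ : {γ : ℝ // HardyZ γ = 0 ∧ γ ≠ γm ∧ γ ≠ γp},
      (1 / ((γ : ℝ) - γm) ^ 2 + 1 / ((γ : ℝ) - γp) ^ 2) ≤ B / (γm - γp) ^ 2 := by
    refine tsum_le_of_sum_le' (by positivity) fun T => ?_
    rw [le_div_iff₀' hpos]
    have h := hbound (T.map (Function.Embedding.subtype _)) (fun ρ hρ => by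
      obtain ⟨γ, -, rfl⟩ := Finset.mem_map.1 hρ
      exact γ.2)
    rwa [Finset.sum_map] at h
  rw [le_div_iff₀' hpos] at htsum
  refine lt_of_le_of_lt htsum ?_
  linarith
end

section
/- Let f and g be holomorphic functions on a domain Ω ⊆ ℂ such that f(s) = (s−z)g(s) for all s ∈ Ω and g(z) ≠ 0 for some z ∈ Ω. Then ((f''/f')' + (1/4)(f''/f')²)(z) = 3 (g'/g)'(z). -/
open scoped Topology

theorem hasDerivAt_sub_mul {𝕜 : Type*} [NontriviallyNormedField 𝕜] {h : 𝕜 → 𝕜} {s : 𝕜}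
    (hh : DifferentiableAt 𝕜 h s) (z : 𝕜) :
    HasDerivAt (fun t => (t - z) * h t) (h s + (s - z) * deriv h s) s := by
  simpa using ((hasDerivAt_id s).sub_const z).fun_mul hh.hasDerivAt


/-- Lemma 1: if `f, g` are holomorphic on a domain `Ω ⊆ ℂ` with `f(s) = (s−z)g(s)` on `Ω`
and `g(z) ≠ 0` for some `z ∈ Ω`, then `((f''/f')' + (1/4)(f''/f')²)(z) = 3(g'/g)'(z)`. -/
theorem schwarzian_lemma (Ω : Set ℂ) (hΩ : IsOpen Ω) (hΩconn : IsConnected Ω)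
    (f g : ℂ → ℂ) (z : ℂ) (hz : z ∈ Ω)
    (hf : DifferentiableOn ℂ f Ω) (hg : DifferentiableOn ℂ g Ω)
    (hfg : ∀ s ∈ Ω, f s = (s - z) * g s) (hgz : g z ≠ 0) :
    deriv (fun s => deriv (deriv f) s / deriv f s) z +
      1 / 4 * (deriv (deriv f) z / deriv f z) ^ 2 =
    3 * deriv (fun s => deriv g s / g s) z := by
  have hU : Ω ∈ 𝓝 z := hΩ.mem_nhds hz
  have hg' : DifferentiableOn ℂ (deriv g) Ω := hg.deriv hΩ
  have hg'' : DifferentiableOn ℂ (deriv (deriv g)) Ω := hg'.deriv hΩ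
  have df : Set.EqOn (deriv f) (fun s => g s + (s - z) * deriv g s) Ω := fun s hs => by
    rw [(Filter.eventuallyEq_of_mem (hΩ.mem_nhds hs) hfg).deriv_eq,
      (hasDerivAt_sub_mul (hg.differentiableAt (hΩ.mem_nhds hs)) z).deriv]
  have ddf : Set.EqOn (deriv (deriv f))
      (fun s => 2 * deriv g s + (s - z) * deriv (deriv g) s) Ω := fun s hs => by
    have hgs := hg.differentiableAt (hΩ.mem_nhds hs)
    have hgs' := hg'.differentiableAt (hΩ.mem_nhds hs)
    rw [(Filter.eventuallyEq_of_mem (hΩ.mem_nhds hs) df).deriv_eq,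
      (hgs.hasDerivAt.fun_add (hasDerivAt_sub_mul hgs' z)).deriv]
    ring
  have dddf : deriv (deriv (deriv f)) z = 3 * deriv (deriv g) z := by
    have hgz' := hg'.differentiableAt hU
    have hgz'' := hg''.differentiableAt hU
    rw [(Filter.eventuallyEq_of_mem hU ddf).deriv_eq,
      ((hgz'.hasDerivAt.const_mul 2).fun_add (hasDerivAt_sub_mul hgz'' z)).deriv]
    ring
  have hfz : deriv f z = g z := by simp [df hz]
  have hfz' : deriv (deriv f) z = 2 * deriv g z := by simp [ddf hz]
  rw [deriv_fun_div (((hf.deriv hΩ).deriv hΩ).differentiableAt hU)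
      ((hf.deriv hΩ).differentiableAt hU) (hfz ▸ hgz),
    deriv_fun_div (hg'.differentiableAt hU) (hg.differentiableAt hU) hgz, dddf, hfz', hfz]
  field_simp
  ring
end

section
/- Let ζ(s,z) = Σ_{n=0}^∞ (z+n)^{−s} denote the Hurwitz zeta-function. For every real t > 1 one has −56t²/(4t²+1)² < Re{ζ(2, 1/4 + i t/2)} < 3/(2t²). -/
/-- The Hurwitz zeta function `ζ(s,z) = Σ_{n=0}^∞ (z+n)^{−s}` at `s = 2`. -/
noncomputable def hurwitzZetaTwo (z : ℂ) : ℂ := ∑' n : ℕ, 1 / (z + n) ^ 2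

open Filter Topology

/-- The first two terms of the asymptotic expansion of `ζ(2,w)`. -/
noncomputable def hurwitzMainTerm (w : ℂ) : ℂ := 1 / w + 1 / (2 * w ^ 2)

lemma add_natCast_ne_zero_of_re_pos {w : ℂ} (hw : 0 < w.re) (n : ℕ) : w + n ≠ 0 := by
  intro h
  have h' := congrArg Complex.re h
  simp only [Complex.add_re, Complex.natCast_re, Complex.zero_re] at h'
  have : (0 : ℝ) ≤ n := n.cast_nonneg
  linarith

lemma summable_one_div_add_natCast_sq {w : ℂ} (hw : 0 < w.re) :
    Summable fun n : ℕ => 1 / (w + n) ^ 2 := by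
  have h := (Real.summable_one_div_nat_add_rpow w.re 2).2 one_lt_two
  refine Summable.of_norm_bounded h fun n => ?_
  have hn : (0 : ℝ) ≤ n := n.cast_nonneg
  have hre : n + w.re ≤ ‖w + n‖ := by
    simpa [add_comm] using Complex.re_le_norm (w + n)
  rw [norm_div, norm_one, norm_pow, abs_of_pos (by linarith), Real.rpow_two]
  gcongr

lemma tendsto_hurwitzMainTerm_add_natCast (w : ℂ) :
    Tendsto (fun n : ℕ => hurwitzMainTerm (w + n)) atTop (𝓝 0) := by
  have h : Tendsto (fun n : ℕ => (w + n)⁻¹) atTop (𝓝 0) :=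
    tendsto_inv₀_cobounded.comp
      ((tendsto_const_add_cobounded w).comp tendsto_natCast_atTop_cobounded)
  have h2 := h.add ((h.pow 2).const_mul (1 / 2))
  simp only [ne_eq, OfNat.ofNat_ne_zero, not_false_eq_true, zero_pow, mul_zero, add_zero] at h2
  refine h2.congr fun n => ?_
  rw [hurwitzMainTerm, ← one_div_mul_one_div, one_div (w + n), one_div ((w + n) ^ 2), inv_pow]

lemma one_div_sq_sub_hurwitzMainTerm {w : ℂ} (h0 : w ≠ 0) (h1 : w + 1 ≠ 0) :
    1 / w ^ 2 - hurwitzMainTerm w + hurwitzMainTerm (w + 1) = 1 / (2 * (w ^ 2 * (w + 1) ^ 2)) := by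
  simp only [hurwitzMainTerm]
  field_simp
  ring

lemma norm_sum_range_sub_hurwitzMainTerm_le {w : ℂ} (hw : 0 < w.re) (N : ℕ) :
    ‖∑ n ∈ Finset.range N, 1 / (w + n) ^ 2 - hurwitzMainTerm w + hurwitzMainTerm (w + N)‖ ≤
      1 / (2 * ‖w‖ ^ 2) * (1 / (w.re + 1 / 2) - 1 / (w.re + N + 1 / 2)) := by
  induction N with
  | zero => simp
  | succ N ih =>
    have hN : (0 : ℝ) ≤ N := N.cast_nonneg
    have h0 := add_natCast_ne_zero_of_re_pos hw N
    have h1 := add_natCast_ne_zero_of_re_pos hw (N + 1)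
    have key := one_div_sq_sub_hurwitzMainTerm h0 (by simpa [add_assoc] using h1)
    have hwpos : 0 < ‖w‖ := hw.trans_le (Complex.re_le_norm w)
    have hnorm : ‖w‖ ≤ ‖w + N‖ := by
      rw [← sq_le_sq₀ (norm_nonneg _) (norm_nonneg _), Complex.sq_norm, Complex.sq_norm,
        Complex.normSq_apply, Complex.normSq_apply]
      simp only [Complex.add_re, Complex.add_im, Complex.natCast_re, Complex.natCast_im, add_zero]
      nlinarith
    have hre : w.re + N + 1 ≤ ‖w + N + 1‖ := by
      simpa using Complex.re_le_norm (w + N + 1)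
    have hterm : ‖1 / (2 * ((w + N) ^ 2 * (w + N + 1) ^ 2))‖ ≤
        1 / (2 * ‖w‖ ^ 2) * (1 / (w.re + N + 1 / 2) - 1 / (w.re + N + 1 + 1 / 2)) := by
      have hle : 1 / (2 * ‖w‖ ^ 2) * (1 / (w.re + N + 1) ^ 2) ≤
          1 / (2 * ‖w‖ ^ 2) * (1 / (w.re + N + 1 / 2) - 1 / (w.re + N + 1 + 1 / 2)) := by
        gcongr
        rw [div_sub_div _ _ (by positivity) (by positivity),
          div_le_div_iff₀ (by positivity) (by positivity)]
        nlinarith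
      refine le_trans ?_ hle
      rw [norm_div, norm_mul, norm_mul, norm_pow, norm_pow, norm_one, Complex.norm_ofNat,
        one_div_mul_one_div, mul_assoc]
      gcongr
    rw [Finset.sum_range_succ]
    have hsplit : ∑ n ∈ Finset.range N, 1 / (w + n) ^ 2 + 1 / (w + N) ^ 2 - hurwitzMainTerm w +
        hurwitzMainTerm (w + (N + 1 : ℕ)) =
        (∑ n ∈ Finset.range N, 1 / (w + n) ^ 2 - hurwitzMainTerm w + hurwitzMainTerm (w + N)) +
          1 / (2 * ((w + N) ^ 2 * (w + N + 1) ^ 2)) := by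
      rw [← key]
      push_cast
      rw [← add_assoc w]
      ring
    rw [hsplit]
    refine (norm_add_le_of_le ih hterm).trans_eq ?_
    rw [← mul_add, sub_add_sub_cancel, Nat.cast_succ, ← add_assoc w.re]

lemma norm_hurwitzZetaTwo_sub_hurwitzMainTerm_le {w : ℂ} (hw : 0 < w.re) :
    ‖hurwitzZetaTwo w - hurwitzMainTerm w‖ ≤ 1 / (2 * ‖w‖ ^ 2) * (1 / (w.re + 1 / 2)) := by
  have hlim := (((summable_one_div_add_natCast_sq hw).hasSum.tendsto_sum_nat.sub_const
    (hurwitzMainTerm w)).add (tendsto_hurwitzMainTerm_add_natCast w)).norm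
  rw [add_zero] at hlim
  refine le_of_tendsto' hlim fun N => (norm_sum_range_sub_hurwitzMainTerm_le hw N).trans ?_
  gcongr
  exact sub_le_self _ (by positivity)

lemma hurwitzZetaTwo_eq_add {w : ℂ} (hw : 0 < w.re) :
    hurwitzZetaTwo w = 1 / w ^ 2 + hurwitzZetaTwo (w + 1) := by
  rw [hurwitzZetaTwo, (summable_one_div_add_natCast_sq hw).tsum_eq_zero_add, hurwitzZetaTwo]
  simp [add_assoc, add_comm (1 : ℂ)]

lemma norm_hurwitzZetaTwo_sub_hurwitzMainTerm_le_shift {w : ℂ} (hw : 0 < w.re) :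
    ‖hurwitzZetaTwo w - hurwitzMainTerm w‖ ≤
      1 / (2 * (‖w‖ ^ 2 * ‖w + 1‖ ^ 2)) + 1 / (2 * ‖w + 1‖ ^ 2) * (1 / (w.re + 3 / 2)) := by
  have hw1 : 0 < (w + 1).re := by simp only [Complex.add_re, Complex.one_re]; linarith
  have h0 : w ≠ 0 := by simpa using add_natCast_ne_zero_of_re_pos hw 0
  have h1 : w + 1 ≠ 0 := by simpa using add_natCast_ne_zero_of_re_pos hw 1
  have htail := norm_hurwitzZetaTwo_sub_hurwitzMainTerm_le hw1
  have hsplit : hurwitzZetaTwo w - hurwitzMainTerm w =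
      1 / (2 * (w ^ 2 * (w + 1) ^ 2)) + (hurwitzZetaTwo (w + 1) - hurwitzMainTerm (w + 1)) := by
    rw [hurwitzZetaTwo_eq_add hw, ← one_div_sq_sub_hurwitzMainTerm h0 h1]
    ring
  rw [hsplit]
  refine norm_add_le_of_le (by simp) (htail.trans_eq ?_)
  rw [Complex.add_re, Complex.one_re, show w.re + 1 + 1 / 2 = w.re + 3 / 2 by ring]

/-- Lemma 2: for real `t > 1`,
`−56t²/(4t²+1)² < Re ζ(2, 1/4 + it/2) < 3/(2t²)`. -/
theorem hurwitz_re_bounds (t : ℝ) (ht : 1 < t) :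
    -56 * t ^ 2 / (4 * t ^ 2 + 1) ^ 2 <
      (hurwitzZetaTwo (1 / 4 + Complex.I * t / 2)).re ∧
    (hurwitzZetaTwo (1 / 4 + Complex.I * t / 2)).re < 3 / (2 * t ^ 2) := by
  set w : ℂ := 1 / 4 + Complex.I * t / 2 with hw
  have hwre : w.re = 1 / 4 := by simp [hw]
  have hwim : w.im = t / 2 := by simp [hw]
  have hn0 : ‖w‖ ^ 2 = (4 * t ^ 2 + 1) / 16 := by
    rw [Complex.sq_norm, Complex.normSq_apply, hwre, hwim]; ring
  have hn1 : ‖w + 1‖ ^ 2 = (4 * t ^ 2 + 25) / 16 := by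
    rw [Complex.sq_norm, Complex.normSq_apply, Complex.add_re, Complex.add_im, hwre, hwim,
      Complex.one_re, Complex.one_im]
    ring
  have hmain : (hurwitzMainTerm w).re = (12 - 16 * t ^ 2) / (4 * t ^ 2 + 1) ^ 2 := by
    have hsq : Complex.normSq w = (4 * t ^ 2 + 1) / 16 := by rw [← Complex.sq_norm, hn0]
    have : hurwitzMainTerm w = w⁻¹ + (1 / 2 : ℝ) * (w⁻¹ * w⁻¹) := by
      rw [hurwitzMainTerm, ← one_div_mul_one_div, sq, ← one_div_mul_one_div]
      simp only [one_div, Complex.ofReal_inv, Complex.ofReal_ofNat]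
    rw [this, Complex.add_re, Complex.re_ofReal_mul, Complex.mul_re, Complex.inv_re,
      Complex.inv_im, hsq, hwre, hwim]
    field_simp
    ring
  have hbound := (Complex.abs_re_le_norm _).trans
    (norm_hurwitzZetaTwo_sub_hurwitzMainTerm_le_shift (w := w) (by rw [hwre]; norm_num))
  rw [hn0, hn1, hwre, Complex.sub_re, hmain, abs_le] at hbound
  have ht2 : 1 < t ^ 2 := by nlinarith
  generalize t ^ 2 = s at *
  obtain ⟨hl, hu⟩ := hbound
  have hB : 1 / (2 * ((4 * s + 1) / 16 * ((4 * s + 25) / 16))) +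
      1 / (2 * ((4 * s + 25) / 16)) * (1 / (1 / 4 + 3 / 2)) =
      (128 * s + 928) / (7 * ((4 * s + 1) * (4 * s + 25))) := by
    field_simp
    ring
  rw [hB] at hl hu
  obtain ⟨u, hu0, rfl⟩ : ∃ u : ℝ, 0 < u ∧ s = 1 + u := ⟨s - 1, by linarith, by ring⟩
  constructor
  · have hpos : 0 < (12 - 16 * (1 + u)) / (4 * (1 + u) + 1) ^ 2 -
        (128 * (1 + u) + 928) / (7 * ((4 * (1 + u) + 1) * (4 * (1 + u) + 25))) -
        -56 * (1 + u) / (4 * (1 + u) + 1) ^ 2 := by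
      field_simp
      ring_nf
      positivity
    linarith
  · have hpos : 0 < 3 / (2 * (1 + u)) - (12 - 16 * (1 + u)) / (4 * (1 + u) + 1) ^ 2 -
        (128 * (1 + u) + 928) / (7 * ((4 * (1 + u) + 1) * (4 * (1 + u) + 25))) := by
      field_simp
      ring_nf
      positivity
    linarith
end

section
/- Let γ₀ > 0 be a simple real zero of Hardy's Z-function and set ρ₀ := 1/2 + iγ₀. Then F̃(ρ₀) := (ζ'''/ζ' − (3/4)(ζ''/ζ')²)(ρ₀) = F̂(γ₀) + 3i ϑ''(γ₀), and this is the decomposition of F̃(ρ₀) into real and imaginary parts (i.e. F̂(γ₀) and 3ϑ''(γ₀) are real). -/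
open Complex

open Filter Topology Set

/-- Partial sums for a continuous argument of `Γ(1/4 + iy)`. -/
noncomputable def gammaPhaseSeq (y : ℝ) (n : ℕ) : ℝ :=
  y * Real.log (n + 3 / 4) - ∑ k ∈ Finset.range (n + 1), Real.arctan (y / (k + 1 / 4))

lemma gammaPhaseSeq_succ (y : ℝ) (n : ℕ) :
    gammaPhaseSeq y (n + 1) = gammaPhaseSeq y n +
      (y * (Real.log (n + 7 / 4) - Real.log (n + 3 / 4)) - Real.arctan (y / (n + 5 / 4))) := by
  simp only [gammaPhaseSeq]
  rw [Finset.sum_range_succ _ (n + 1)]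
  push_cast
  rw [show (n : ℝ) + 1 + 3 / 4 = n + 7 / 4 by ring, show (n : ℝ) + 1 + 1 / 4 = n + 5 / 4 by ring]
  ring

lemma Real.arctan_le_self_of_nonneg {x : ℝ} (hx : 0 ≤ x) : Real.arctan x ≤ x := by
  simpa using Real.le_tan (Real.arctan_nonneg.2 hx) (Real.arctan_lt_pi_div_two x)

lemma Real.div_one_add_sq_le_arctan {x : ℝ} (hx : 0 ≤ x) : x / (1 + x ^ 2) ≤ Real.arctan x := by
  have h := Real.sin_le (Real.arctan_nonneg.2 hx)
  rw [Real.sin_arctan] at h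
  refine le_trans ?_ h
  gcongr
  rw [Real.sqrt_le_left (by positivity)]
  nlinarith [sq_nonneg x]

lemma log_add_seven_fourths_sub_log (n : ℕ) :
    Real.log (n + 7 / 4) - Real.log (n + 3 / 4) = Real.log (1 + 1 / (n + 3 / 4)) := by
  rw [← Real.log_div (by positivity) (by positivity)]
  congr 1
  field_simp
  ring

lemma gammaPhaseSeq_mono {y : ℝ} (hy : 0 ≤ y) : Monotone (gammaPhaseSeq y) := by
  refine monotone_nat_of_le_succ fun n ↦ ?_
  rw [gammaPhaseSeq_succ, log_add_seven_fourths_sub_log]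
  have h1 := Real.le_log_one_add_of_nonneg (x := 1 / ((n : ℝ) + 3 / 4)) (by positivity)
  have h2 : 2 * (1 / ((n : ℝ) + 3 / 4)) / (1 / ((n : ℝ) + 3 / 4) + 2) = 1 / (n + 5 / 4) := by
    field_simp
    ring
  rw [h2] at h1
  have h3 := Real.arctan_le_self_of_nonneg (x := y / (n + 5 / 4)) (by positivity)
  have h4 := mul_le_mul_of_nonneg_left h1 hy
  rw [mul_one_div] at h4
  linarith

lemma gammaPhaseSeq_add_antitone {y : ℝ} (hy : 0 ≤ y) :
    Antitone fun n : ℕ ↦ gammaPhaseSeq y n + y * (y ^ 2 + 2) / (n + 3 / 4) := by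
  refine antitone_nat_of_succ_le fun n ↦ ?_
  rw [gammaPhaseSeq_succ, log_add_seven_fourths_sub_log]
  have h1 := Real.log_le_sub_one_of_pos (x := 1 + 1 / ((n : ℝ) + 3 / 4)) (by positivity)
  have h2 := mul_le_mul_of_nonneg_left h1 hy
  have h3 := Real.div_one_add_sq_le_arctan (x := y / (n + 5 / 4)) (by positivity)
  have h4 : y * (1 + 1 / ((n : ℝ) + 3 / 4) - 1) + y * (y ^ 2 + 2) / ((n + 1 : ℕ) + 3 / 4) ≤
      y / (n + 5 / 4) / (1 + (y / (n + 5 / 4)) ^ 2) + y * (y ^ 2 + 2) / (n + 3 / 4) := by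
    push_cast
    have hn : (0 : ℝ) ≤ n := n.cast_nonneg
    generalize (n : ℝ) = m at *
    have e : y / (m + 5 / 4) / (1 + (y / (m + 5 / 4)) ^ 2) =
        y * ((m + 5 / 4) / ((m + 5 / 4) ^ 2 + y ^ 2)) := by
      field_simp
    have e2 : y * (1 + 1 / (m + 3 / 4) - 1) + y * (y ^ 2 + 2) / (m + 1 + 3 / 4) =
        y * (1 / (m + 3 / 4) + (y ^ 2 + 2) / (m + 1 + 3 / 4)) := by ring
    have e3 : y * ((m + 5 / 4) / ((m + 5 / 4) ^ 2 + y ^ 2)) + y * (y ^ 2 + 2) / (m + 3 / 4) =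
        y * ((m + 5 / 4) / ((m + 5 / 4) ^ 2 + y ^ 2) + (y ^ 2 + 2) / (m + 3 / 4)) := by ring
    rw [e, e2, e3]
    refine mul_le_mul_of_nonneg_left ?_ hy
    rw [div_add_div _ _ (by positivity) (by positivity),
      div_add_div _ _ (by positivity) (by positivity), div_le_div_iff₀ (by positivity)
      (by positivity), ← sub_nonneg]
    have : 0 ≤ (m + 3 / 4) * (((y ^ 2 + 2) * ((m + 5 / 4) ^ 2 + y ^ 2)) -
        (y ^ 2 + (m + 5 / 4) / 2) * (m + 7 / 4)) := by
      refine mul_nonneg (by positivity) ?_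
      nlinarith [sq_nonneg y, sq_nonneg (y ^ 2), mul_nonneg (sq_nonneg y) hn,
        mul_nonneg (sq_nonneg y) (sq_nonneg m), sq_nonneg m]
    refine this.trans_eq ?_
    ring
  linarith

lemma convexOn_neg_arctan_div {c : ℝ} (hc : 0 < c) :
    ConvexOn ℝ (Ici 0) fun y : ℝ ↦ -Real.arctan (y / c) := by
  have hd (y : ℝ) : HasDerivAt (fun y : ℝ ↦ -Real.arctan (y / c))
      (-(1 / (1 + (y / c) ^ 2) * (1 / c))) y :=
    (((hasDerivAt_id y).div_const c).arctan).neg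
  refine MonotoneOn.convexOn_of_deriv (convex_Ici 0)
    (fun y _ ↦ (hd y).continuousAt.continuousWithinAt)
    (fun y _ ↦ (hd y).differentiableAt.differentiableWithinAt) ?_
  intro a ha b hb hab
  rw [(hd a).deriv, (hd b).deriv]
  rw [interior_Ici] at ha hb
  have ha' : 0 < a := ha
  gcongr

lemma convexOn_gammaPhaseSeq (n : ℕ) : ConvexOn ℝ (Ici 0) fun y ↦ gammaPhaseSeq y n := by
  have h1 : ConvexOn ℝ (Ici 0) fun y : ℝ ↦ y * Real.log (n + 3 / 4) :=
    ((LinearMap.mul ℝ ℝ).flip (Real.log (n + 3 / 4))).convexOn (convex_Ici 0)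
  have h2 (s : Finset ℕ) :
      ConvexOn ℝ (Ici 0) fun y : ℝ ↦ ∑ k ∈ s, -Real.arctan (y / (k + 1 / 4)) := by
    induction s using Finset.induction_on with
    | empty => simpa using convexOn_const (0 : ℝ) (convex_Ici (0 : ℝ))
    | insert k s hk ih =>
      simp only [Finset.sum_insert hk]
      exact (convexOn_neg_arctan_div (by positivity)).add ih
  refine (h1.add (h2 (Finset.range (n + 1)))).congr fun y _ ↦ ?_
  simp [gammaPhaseSeq, sub_eq_add_neg]

lemma le_log_seven_fourths : (36 / 65 : ℝ) ≤ Real.log (7 / 4) := by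
  rw [Real.le_log_iff_exp_le (by norm_num)]
  refine le_of_pow_le_pow_left₀ (n := 65) (by norm_num) (by norm_num) ?_
  rw [← Real.exp_nat_mul]
  have h : Real.exp ((65 : ℕ) * (36 / 65)) = Real.exp 1 ^ 36 := by
    rw [← Real.exp_nat_mul]
    norm_num
  rw [h]
  refine (pow_le_pow_left₀ (Real.exp_pos 1).le Real.exp_one_lt_d9.le 36).trans ?_
  norm_num

lemma neg_pi_div_two_lt_gammaPhaseSeq_one {y : ℝ} (hy : 0 ≤ y) :
    -(Real.pi / 2) < gammaPhaseSeq y 1 := by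
  have hs : gammaPhaseSeq y 1 =
      y * Real.log (7 / 4) - Real.arctan (y / (1 / 4)) - Real.arctan (y / (5 / 4)) := by
    simp [gammaPhaseSeq, Finset.sum_range_succ]
    norm_num
    ring
  have hmul := mul_le_mul_of_nonneg_left le_log_seven_fourths hy
  let F : ℝ → ℝ := fun y ↦ y * (36 / 65) + -Real.arctan (y / (1 / 4)) + -Real.arctan (y / (5 / 4))
  have hF : ConvexOn ℝ (Ici 0) F :=
    ((((LinearMap.mul ℝ ℝ).flip (36 / 65 : ℝ)).convexOn (convex_Ici 0)).add
      (convexOn_neg_arctan_div (by norm_num))).add (convexOn_neg_arctan_div (by norm_num))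
  have hd : HasDerivAt F 0 (5 / 4) := by
    have h1 := ((hasDerivAt_id (5 / 4 : ℝ)).mul_const (36 / 65 : ℝ))
    have h2 := (((hasDerivAt_id (5 / 4 : ℝ)).div_const (1 / 4)).arctan).neg
    have h3 := (((hasDerivAt_id (5 / 4 : ℝ)).div_const (5 / 4)).arctan).neg
    convert! (h1.add h2).add h3 using 1
    norm_num
  have hmin := hF.isMinOn_of_rightDeriv_eq_zero (x := 5 / 4) (by simp)
    (hd.hasDerivWithinAt.derivWithin (uniqueDiffWithinAt_Ioi _))
  have hle : F (5 / 4) ≤ F y := hmin (mem_Ici.2 hy)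
  have h5 : Real.arctan 5 ≤ Real.pi / 4 + 2 / 3 := by
    have h := Real.arctan_add (x := 1) (y := 2 / 3) (by norm_num)
    rw [Real.arctan_one] at h
    have h' := Real.arctan_le_self_of_nonneg (x := 2 / 3) (by norm_num)
    norm_num at h
    linarith
  have hF0 : F (5 / 4) = 9 / 13 - Real.arctan 5 - Real.pi / 4 := by
    simp only [F]
    norm_num [Real.arctan_one]
    ring
  simp only [F] at hle hF0
  linarith

/-- `z` is a nonnegative real multiple of `exp (iθ)`. -/
def HasPhase (z : ℂ) (θ : ℝ) : Prop := ∃ r : ℝ, 0 ≤ r ∧ z = r * cexp (θ * I)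

lemma HasPhase.mul {z w : ℂ} {θ φ : ℝ} (hz : HasPhase z θ) (hw : HasPhase w φ) :
    HasPhase (z * w) (θ + φ) := by
  obtain ⟨r, hr, rfl⟩ := hz
  obtain ⟨s, hs, rfl⟩ := hw
  refine ⟨r * s, by positivity, ?_⟩
  push_cast
  rw [add_mul, Complex.exp_add]
  ring

lemma HasPhase.inv {z : ℂ} {θ : ℝ} (hz : HasPhase z θ) : HasPhase z⁻¹ (-θ) := by
  obtain ⟨r, hr, rfl⟩ := hz
  refine ⟨r⁻¹, by positivity, ?_⟩
  push_cast
  rw [mul_inv, neg_mul, Complex.exp_neg]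

lemma hasPhase_ofReal {r : ℝ} (hr : 0 ≤ r) : HasPhase r 0 := ⟨r, hr, by simp⟩

lemma hasPhase_arctan {x : ℝ} (hx : 0 < x) (y : ℝ) :
    HasPhase (x + I * y) (Real.arctan (y / x)) := by
  refine ⟨x * √(1 + (y / x) ^ 2), by positivity, ?_⟩
  have h0 : √(1 + (y / x) ^ 2) ≠ 0 := by positivity
  rw [Complex.exp_mul_I, ← Complex.ofReal_cos, ← Complex.ofReal_sin, Real.cos_arctan,
    Real.sin_arctan]
  have hx' : (x : ℂ) ≠ 0 := by exact_mod_cast hx.ne'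
  have h0' : (√(1 + (y / x) ^ 2) : ℂ) ≠ 0 := by exact_mod_cast h0
  push_cast
  generalize (√(1 + (y / x) ^ 2) : ℂ) = q at h0'
  field_simp

lemma hasPhase_prod (f : ℕ → ℂ) (θ : ℕ → ℝ) (h : ∀ k, HasPhase (f k) (θ k)) (s : Finset ℕ) :
    HasPhase (∏ k ∈ s, f k) (∑ k ∈ s, θ k) := by
  induction s using Finset.induction_on with
  | empty => simpa using hasPhase_ofReal zero_le_one
  | insert k s hk ih =>
    rw [Finset.prod_insert hk, Finset.sum_insert hk]
    exact (h k).mul ih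

lemma hasPhase_GammaSeq (y : ℝ) {n : ℕ} (hn : 0 < n) :
    HasPhase (Complex.GammaSeq (1 / 4 + I * y) n)
      (y * Real.log n - ∑ k ∈ Finset.range (n + 1), Real.arctan (y / (k + 1 / 4))) := by
  have hn' : (0 : ℝ) < n := by exact_mod_cast hn
  have hpow : HasPhase ((n : ℂ) ^ (1 / 4 + I * y : ℂ)) (y * Real.log n) := by
    refine ⟨(n : ℝ) ^ (1 / 4 : ℝ), by positivity, ?_⟩
    have hnc : (n : ℂ) ≠ 0 := by exact_mod_cast hn.ne'
    rw [Complex.cpow_add _ _ hnc, Complex.ofReal_cpow hn'.le,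
      Complex.cpow_def_of_ne_zero hnc (I * y)]
    push_cast
    congr 2
    ring
  have hfac : HasPhase ((n.factorial : ℕ) : ℂ) 0 := by
    simpa using hasPhase_ofReal (r := (n.factorial : ℝ)) (by positivity)
  have hprod := hasPhase_prod (fun k ↦ (1 / 4 + I * y : ℂ) + k)
    (fun k ↦ Real.arctan (y / (k + 1 / 4))) (fun k ↦ by
      convert! hasPhase_arctan (x := k + 1 / 4) (by positivity) y using 1
      push_cast
      ring) (Finset.range (n + 1))
  have := (hpow.mul hfac).mul hprod.inv
  rw [add_zero, ← sub_eq_add_neg] at this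
  exact this

lemma HasPhase.of_tendsto {z : ℕ → ℂ} {θ : ℕ → ℝ} {w : ℂ} {φ : ℝ}
    (hz : Tendsto z atTop (𝓝 w)) (hθ : Tendsto θ atTop (𝓝 φ))
    (h : ∀ᶠ n in atTop, HasPhase (z n) (θ n)) : HasPhase w φ := by
  have hlim : Tendsto (fun n ↦ z n * cexp (-(θ n * I))) atTop (𝓝 (w * cexp (-(φ * I)))) := by
    refine hz.mul (Tendsto.cexp (Tendsto.neg (Tendsto.mul_const _ ?_)))
    exact (Complex.continuous_ofReal.tendsto φ).comp hθ
  have hreal : ∀ᶠ n in atTop, ∃ r : ℝ, 0 ≤ r ∧ z n * cexp (-(θ n * I)) = r := by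
    filter_upwards [h] with n ⟨r, hr, hn⟩
    refine ⟨r, hr, ?_⟩
    rw [hn, mul_assoc, ← Complex.exp_add]
    simp
  have him : (w * cexp (-(φ * I))).im = 0 := by
    refine tendsto_nhds_unique ((Complex.continuous_im.tendsto _).comp hlim) ?_
    refine tendsto_const_nhds.congr' ?_
    filter_upwards [hreal] with n ⟨r, hr, hn⟩
    simp [hn]
  have hre : 0 ≤ (w * cexp (-(φ * I))).re := by
    refine ge_of_tendsto ((Complex.continuous_re.tendsto _).comp hlim) ?_
    filter_upwards [hreal] with n ⟨r, hr, hn⟩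
    simpa [hn] using hr
  refine ⟨_, hre, ?_⟩
  have : ((w * cexp (-(φ * I))).re : ℂ) = w * cexp (-(φ * I)) := by
    apply Complex.ext <;> simp [him]
  rw [this, mul_assoc, ← Complex.exp_add]
  simp

/-- The continuous argument of `Γ(1/4 + iy)` for `y ≥ 0`. -/
noncomputable def gammaPhase (y : ℝ) : ℝ := ⨆ n, gammaPhaseSeq y n

lemma bddAbove_gammaPhaseSeq {y : ℝ} (hy : 0 ≤ y) : BddAbove (range (gammaPhaseSeq y)) := by
  refine ⟨gammaPhaseSeq y 0 + y * (y ^ 2 + 2) / ((0 : ℕ) + 3 / 4), ?_⟩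
  rintro _ ⟨n, rfl⟩
  have h := gammaPhaseSeq_add_antitone hy (Nat.zero_le n)
  have : 0 ≤ y * (y ^ 2 + 2) / ((n : ℝ) + 3 / 4) := by positivity
  exact (le_add_of_nonneg_right this).trans h

lemma tendsto_gammaPhaseSeq {y : ℝ} (hy : 0 ≤ y) :
    Tendsto (gammaPhaseSeq y) atTop (𝓝 (gammaPhase y)) :=
  tendsto_atTop_ciSup (gammaPhaseSeq_mono hy) (bddAbove_gammaPhaseSeq hy)

lemma convexOn_gammaPhase : ConvexOn ℝ (Ici 0) gammaPhase := by
  refine ⟨convex_Ici 0, fun x hx y hy a b ha hb hab ↦ ?_⟩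
  refine le_of_tendsto_of_tendsto' (tendsto_gammaPhaseSeq (convex_Ici 0 hx hy ha hb hab))
    (((tendsto_gammaPhaseSeq hx).const_smul a).add ((tendsto_gammaPhaseSeq hy).const_smul b))
    fun n ↦ (convexOn_gammaPhaseSeq n).2 hx hy ha hb hab

lemma gammaPhase_zero : gammaPhase 0 = 0 := by
  simp [gammaPhase, gammaPhaseSeq]

lemma neg_pi_div_two_lt_gammaPhase {y : ℝ} (hy : 0 ≤ y) : -(Real.pi / 2) < gammaPhase y :=
  (neg_pi_div_two_lt_gammaPhaseSeq_one hy).trans_le (le_ciSup (bddAbove_gammaPhaseSeq hy) 1)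

lemma hasPhase_Gamma {y : ℝ} (hy : 0 ≤ y) :
    HasPhase (Complex.Gamma (1 / 4 + I * y)) (gammaPhase y) := by
  refine HasPhase.of_tendsto (Complex.GammaSeq_tendsto_Gamma _) ?_
    ((eventually_gt_atTop 0).mono fun n hn ↦ hasPhase_GammaSeq y hn)
  have hlog : Tendsto (fun n : ℕ ↦ Real.log (1 + 3 / 4 / n)) atTop (𝓝 0) := by
    have : Tendsto (fun n : ℕ ↦ 1 + (3 / 4 : ℝ) / n) atTop (𝓝 (1 + 0)) :=
      (tendsto_const_div_atTop_nhds_zero_nat _).const_add 1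
    rw [add_zero] at this
    simpa using this.log one_ne_zero
  have h := (tendsto_gammaPhaseSeq hy).sub (hlog.const_mul y)
  rw [mul_zero, sub_zero] at h
  refine h.congr' ?_
  filter_upwards [eventually_gt_atTop 0] with n hn
  have hn' : (0 : ℝ) < n := by exact_mod_cast hn
  have : Real.log (1 + 3 / 4 / n) = Real.log (n + 3 / 4) - Real.log n := by
    rw [← Real.log_div (by positivity) hn'.ne']
    congr 1
    field_simp
  rw [this, gammaPhaseSeq]
  ring

lemma not_isLocalMin_gammaPhase {y : ℝ} (hy : 0 < y)
    (h : cexp (2 * gammaPhase y * I) = -1) : ¬ IsLocalMin gammaPhase y := by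
  intro hmin
  have h0 : gammaPhase y ≤ gammaPhase 0 :=
    IsMinOn.of_isLocalMinOn_of_convexOn (mem_Ici.2 hy.le) (hmin.on _) convexOn_gammaPhase
      (mem_Ici.2 le_rfl)
  rw [gammaPhase_zero] at h0
  have h1 := neg_pi_div_two_lt_gammaPhase hy.le
  have h2 : Real.cos (2 * gammaPhase y) = -1 := by
    have := congrArg Complex.re h
    rw [← Complex.ofReal_ofNat, ← Complex.ofReal_mul, Complex.exp_ofReal_mul_I_re] at this
    simpa using this
  rw [Real.cos_eq_neg_one_iff] at h2
  obtain ⟨k, hk⟩ := h2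
  have hpi := Real.pi_pos
  have hk1 : (-1 : ℝ) < k := by
    by_contra! hc
    nlinarith
  have hk0 : (k : ℝ) < 0 := by
    by_contra! hc
    nlinarith
  have : (-1 : ℤ) < k := by exact_mod_cast hk1
  have : k < 0 := by exact_mod_cast hk0
  omega

/-- The unimodular ratio `Γ(1/4 + it/2) / Γ(1/4 - it/2)`. -/
noncomputable def gammaRatio (t : ℝ) : ℂ :=
  Complex.Gamma (1 / 4 + I * t / 2) / Complex.Gamma (1 / 4 - I * t / 2)

lemma Gamma_quarter_add_ne_zero (t : ℝ) : Complex.Gamma (1 / 4 + I * t / 2) ≠ 0 :=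
  Complex.Gamma_ne_zero_of_re_pos (by simp)

lemma Gamma_quarter_sub (t : ℝ) : Complex.Gamma (1 / 4 - I * t / 2) =
    (starRingEnd ℂ) (Complex.Gamma (1 / 4 + I * t / 2)) := by
  rw [← Complex.Gamma_conj]
  congr 1
  simp [Complex.conj_ofNat]
  ring

lemma norm_gammaRatio (t : ℝ) : ‖gammaRatio t‖ = 1 := by
  rw [gammaRatio, Gamma_quarter_sub, norm_div, RCLike.norm_conj, div_self]
  exact norm_ne_zero_iff.2 (Gamma_quarter_add_ne_zero t)

lemma gammaRatio_eq_exp {t : ℝ} (ht : 0 ≤ t) :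
    gammaRatio t = cexp (2 * gammaPhase (t / 2) * I) := by
  have h0 := Gamma_quarter_add_ne_zero t
  obtain ⟨r, -, hr⟩ := hasPhase_Gamma (y := t / 2) (by positivity)
  have e : Complex.Gamma (1 / 4 + I * t / 2) = r * cexp (gammaPhase (t / 2) * I) := by
    rw [← hr]
    congr 1
    push_cast
    ring
  have hr0 : (r : ℂ) ≠ 0 := by
    rintro h
    rw [e, h, zero_mul] at h0
    exact h0 rfl
  rw [gammaRatio, Gamma_quarter_sub, e, map_mul, Complex.conj_ofReal, ← Complex.exp_conj,
    map_mul, Complex.conj_ofReal, Complex.conj_I, mul_div_mul_left _ _ hr0, ← Complex.exp_sub]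
  congr 1
  ring

lemma analyticAt_gammaRatio (t : ℝ) : AnalyticAt ℝ gammaRatio t := by
  have hG (z : ℂ) (hz : 0 < z.re) : AnalyticAt ℝ Complex.Gamma z := by
    have hd : DifferentiableOn ℂ Complex.Gamma {z | 0 < z.re} := fun w hw ↦
      (Complex.differentiableAt_Gamma w fun m h ↦ by
        have : 0 < w.re := hw
        rw [h] at this
        simp at this
        linarith [(Nat.cast_nonneg m : (0 : ℝ) ≤ m)]).differentiableWithinAt
    exact (hd.analyticAt
      ((isOpen_lt continuous_const Complex.continuous_re).mem_nhds hz)).restrictScalars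
  have hl : AnalyticAt ℝ (fun t : ℝ ↦ I * (t : ℂ) / 2) t :=
    (analyticAt_const.mul (Complex.ofRealCLM.analyticAt t)).div analyticAt_const two_ne_zero
  refine AnalyticAt.div ?_ ?_ ?_
  · exact (hG _ (by simp)).fun_comp (analyticAt_const.add hl)
  · exact (hG _ (by simp)).fun_comp (analyticAt_const.sub hl)
  · exact Complex.Gamma_ne_zero_of_re_pos (by simp)

lemma RStheta_eq (t : ℝ) :
    RStheta t = (gammaRatio t).arg / 2 - t / 2 * Real.log Real.pi := by
  rw [RStheta, ← gammaRatio, ← Complex.log_im]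
  congr 1
  rw [show (1 / (2 * I) : ℂ) = -(I / 2) by
    rw [one_div, mul_inv, Complex.inv_I]
    ring]
  simp
  ring

lemma exp_I_mul_RStheta (t : ℝ) : cexp (I * RStheta t) =
    cexp (((gammaRatio t).arg / 2 : ℝ) * I) * cexp (-(t / 2 * Real.log Real.pi) * I) := by
  rw [RStheta_eq, ← Complex.exp_add]
  congr 1
  push_cast
  ring

lemma exp_half_arg_sq (t : ℝ) :
    cexp (((gammaRatio t).arg / 2 : ℝ) * I) ^ 2 = gammaRatio t := by
  have h := Complex.norm_mul_exp_arg_mul_I (gammaRatio t)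
  rw [norm_gammaRatio, Complex.ofReal_one, one_mul] at h
  rw [← Complex.exp_nat_mul]
  nth_rw 2 [← h]
  congr 1
  push_cast
  ring

lemma ofReal_HardyZ (t : ℝ) :
    (HardyZ t : ℂ) = cexp (I * RStheta t) * riemannZeta (1 / 2 + I * t) := by
  have hs0 : (1 / 2 + I * t : ℂ) ≠ 0 := fun h ↦ by simpa using congrArg Complex.re h
  have hs1 : (1 - (1 / 2 + I * t) : ℂ) ≠ 0 := fun h ↦ by
    have := congrArg Complex.re h
    norm_num at this
  have hE : cexp (I * RStheta t) ^ 2 = gammaRatio t * cexp (-(t * Real.log Real.pi) * I) := by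
    rw [exp_I_mul_RStheta, mul_pow, exp_half_arg_sq, ← Complex.exp_nat_mul]
    congr 2
    push_cast
    ring
  have hpi : (Real.pi : ℂ) ≠ 0 := by exact_mod_cast Real.pi_ne_zero
  have hconj : (starRingEnd ℂ) (riemannZeta (1 / 2 + I * t)) =
      cexp (I * RStheta t) ^ 2 * riemannZeta (1 / 2 + I * t) := by
    have e1 : (starRingEnd ℂ) (1 / 2 + I * t : ℂ) = 1 - (1 / 2 + I * t) := by
      simp [Complex.conj_ofNat]
      ring
    rw [← riemannZeta_conj, e1, riemannZeta_def_of_ne_zero hs0, riemannZeta_def_of_ne_zero hs1,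
      completedRiemannZeta_one_sub, hE, Complex.Gammaℝ_def, Complex.Gammaℝ_def, gammaRatio,
      show (1 / 2 + I * t : ℂ) / 2 = 1 / 4 + I * t / 2 by ring,
      show (1 - (1 / 2 + I * t) : ℂ) / 2 = 1 / 4 - I * t / 2 by ring,
      Complex.cpow_def_of_ne_zero hpi, Complex.cpow_def_of_ne_zero hpi, ← Complex.ofReal_log
      Real.pi_pos.le]
    have hG1 := Gamma_quarter_add_ne_zero t
    have hG2 : Complex.Gamma (1 / 4 - I * t / 2) ≠ 0 :=
      Complex.Gamma_ne_zero_of_re_pos (by simp)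
    have hexp : cexp (Real.log Real.pi * (-(1 / 2 + I * t) / 2)) =
        cexp (-(t * Real.log Real.pi) * I) *
          cexp (Real.log Real.pi * (-(1 - (1 / 2 + I * t)) / 2)) := by
      rw [← Complex.exp_add]
      congr 1
      ring
    rw [hexp]
    have := Complex.exp_ne_zero (-(t * Real.log Real.pi) * I)
    have := Complex.exp_ne_zero (Real.log Real.pi * (-(1 - (1 / 2 + I * t)) / 2))
    generalize Complex.Gamma (1 / 4 + I * t / 2) = G₁ at *
    generalize Complex.Gamma (1 / 4 - I * t / 2) = G₂ at *
    field_simp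
  have hreal : (starRingEnd ℂ) (cexp (I * RStheta t) * riemannZeta (1 / 2 + I * t)) =
      cexp (I * RStheta t) * riemannZeta (1 / 2 + I * t) := by
    have : (starRingEnd ℂ) (cexp (I * RStheta t)) * cexp (I * RStheta t) = 1 := by
      rw [← Complex.exp_conj, ← Complex.exp_add]
      simp
    rw [map_mul, hconj, sq, ← mul_assoc, ← mul_assoc, this, one_mul]
  exact Complex.conj_eq_iff_re.1 hreal

lemma HardyZ_eq_zero_iff_s14 (t : ℝ) : HardyZ t = 0 ↔ riemannZeta (1 / 2 + I * t) = 0 := by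
  rw [← Complex.ofReal_eq_zero, ofReal_HardyZ, mul_eq_zero, or_iff_right (Complex.exp_ne_zero _)]

lemma hasDerivAt_iteratedDeriv_zeta (k : ℕ) (t : ℝ) :
    HasDerivAt (fun t : ℝ ↦ I ^ k * iteratedDeriv k riemannZeta (1 / 2 + I * t))
      (I ^ (k + 1) * iteratedDeriv (k + 1) riemannZeta (1 / 2 + I * t)) t := by
  have hne : (1 / 2 + I * t : ℂ) ≠ 1 := fun h ↦ by
    have := congrArg Complex.re h
    norm_num at this
  have hd : DifferentiableOn ℂ riemannZeta {1}ᶜ := fun z hz ↦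
    (differentiableAt_riemannZeta hz).differentiableWithinAt
  have ha : AnalyticAt ℂ riemannZeta (1 / 2 + I * t) :=
    hd.analyticAt (isOpen_compl_singleton.mem_nhds hne)
  have h1 : HasDerivAt (iteratedDeriv k riemannZeta)
      (iteratedDeriv (k + 1) riemannZeta (1 / 2 + I * t)) (1 / 2 + I * t) := by
    rw [iteratedDeriv_succ]
    refine DifferentiableAt.hasDerivAt ?_
    rw [iteratedDeriv_eq_iterate]
    exact (ha.iterated_deriv k).differentiableAt
  have h2 : HasDerivAt (fun t : ℝ ↦ (1 / 2 + I * t : ℂ)) I t := by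
    simpa using ((Complex.ofRealCLM.hasDerivAt (x := t)).const_mul I).const_add (1 / 2 : ℂ)
  refine ((HasDerivAt.comp t h1 h2).const_mul (I ^ k)).congr_deriv ?_
  ring

lemma eventually_arg_gammaRatio_nonneg {γ₀ : ℝ} (hγ : 0 < γ₀) (hz : HardyZ γ₀ = 0)
    (hz' : deriv HardyZ γ₀ ≠ 0) (hr : gammaRatio γ₀ = -1) :
    ∀ᶠ t in 𝓝 γ₀, 0 ≤ (gammaRatio t).arg := by
  have hdiff : HasDerivAt HardyZ (deriv HardyZ γ₀) γ₀ :=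
    (differentiableAt_of_deriv_ne_zero hz').hasDerivAt
  set h : ℝ → ℂ := fun t ↦ cexp (((gammaRatio t).arg / 2 : ℝ) * I)
  set g : ℝ → ℂ := fun t ↦
    cexp (-(t / 2 * Real.log Real.pi) * I) * riemannZeta (1 / 2 + I * t) with hg
  have hZ (t : ℝ) : (HardyZ t : ℂ) = h t * g t := by
    rw [ofReal_HardyZ, exp_I_mul_RStheta, mul_assoc]
  have hg0 : g γ₀ = 0 := by
    rw [hg]
    simp only [(HardyZ_eq_zero_iff_s14 γ₀).1 hz, mul_zero]
  obtain ⟨d, hd⟩ : ∃ d, HasDerivAt g d γ₀ := by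
    have h1 := hasDerivAt_iteratedDeriv_zeta 0 γ₀
    simp only [pow_zero, iteratedDeriv_zero, one_mul] at h1
    have h2 : DifferentiableAt ℝ (fun t : ℝ ↦ cexp (-(t / 2 * Real.log Real.pi) * I)) γ₀ := by
      have := (Complex.ofRealCLM.differentiableAt (x := γ₀))
      have h3 : DifferentiableAt ℝ (fun t : ℝ ↦ (t : ℂ)) γ₀ := this
      fun_prop
    exact ⟨_, (h2.mul h1.differentiableAt).hasDerivAt⟩
  have hsZ : Tendsto (fun t ↦ ((slope HardyZ γ₀ t : ℝ) : ℂ)) (𝓝[≠] γ₀)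
      (𝓝 ((deriv HardyZ γ₀ : ℝ) : ℂ)) :=
    (Complex.continuous_ofReal.tendsto _).comp (hasDerivAt_iff_tendsto_slope.1 hdiff)
  have hsg : Tendsto (slope g γ₀) (𝓝[≠] γ₀) (𝓝 d) := hasDerivAt_iff_tendsto_slope.1 hd
  have hslope (t : ℝ) : ((slope HardyZ γ₀ t : ℝ) : ℂ) = h t * slope g γ₀ t := by
    rw [slope_def_field, slope_def_module, hz, hg0, sub_zero, sub_zero]
    push_cast
    rw [hZ, Complex.real_smul]
    push_cast
    ring
  have hnorm (t : ℝ) : ‖h t‖ = 1 := Complex.norm_exp_ofReal_mul_I _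
  have hd0 : d ≠ 0 := by
    have h1 := hsg.norm
    have h2 := hsZ.norm
    simp only [hslope, norm_mul, hnorm, one_mul] at h2
    rw [← norm_ne_zero_iff, tendsto_nhds_unique h1 h2]
    simpa using hz'
  have hlim : Tendsto h (𝓝[≠] γ₀) (𝓝 (((deriv HardyZ γ₀ : ℝ) : ℂ) / d)) := by
    refine (hsZ.div hsg hd0).congr' ?_
    filter_upwards [hsg.eventually_ne hd0] with t ht
    rw [Pi.div_apply, hslope, mul_div_cancel_right₀ _ ht]
  generalize ((deriv HardyZ γ₀ : ℝ) : ℂ) / d = l at hlim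
  have hl : l ^ 2 = -1 := by
    refine tendsto_nhds_unique (hlim.pow 2) ?_
    have h1 : Tendsto gammaRatio (𝓝[≠] γ₀) (𝓝 (gammaRatio γ₀)) :=
      ((analyticAt_gammaRatio γ₀).continuousAt).mono_left nhdsWithin_le_nhds
    rw [hr] at h1
    exact h1.congr fun t ↦ (exp_half_arg_sq t).symm
  have him : Tendsto (fun t ↦ Real.sin ((gammaRatio t).arg / 2)) (𝓝[≠] γ₀) (𝓝 l.im) := by
    refine ((Complex.continuous_im.tendsto l).comp hlim).congr fun t ↦ ?_
    exact Complex.exp_ofReal_mul_I_im _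
  have hl' : l = I ∨ l = -I := by
    rw [← Complex.I_sq, sq_eq_sq_iff_eq_or_eq_neg] at hl
    exact hl
  have hpi := Real.pi_pos
  obtain rfl | rfl := hl'
  · have h1 := him.eventually_const_lt (u := 0) (by simp)
    rw [eventually_nhdsWithin_iff] at h1
    filter_upwards [h1] with t ht
    by_cases hne : t = γ₀
    · rw [hne, hr]
      simpa using hpi.le
    · by_contra! hc
      have h2 := ht hne
      have h3 := Complex.neg_pi_lt_arg (gammaRatio t)
      linarith [Real.sin_neg_of_neg_of_neg_pi_lt (x := (gammaRatio t).arg / 2)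
        (by linarith) (by linarith)]
  · exfalso
    have h1 := him.eventually_lt_const (u := 0) (by simp)
    rw [eventually_nhdsWithin_iff] at h1
    have h2 : Tendsto (fun y : ℝ ↦ 2 * y) (𝓝 (γ₀ / 2)) (𝓝 γ₀) := by
      have : ContinuousAt (fun y : ℝ ↦ 2 * y) (γ₀ / 2) := by fun_prop
      convert! this.tendsto using 2
      ring
    have hcont : ContinuousAt gammaPhase (γ₀ / 2) := by
      refine convexOn_gammaPhase.continuousOn_interior.continuousAt ?_
      rw [interior_Ici]
      exact Ioi_mem_nhds (by positivity)
    have hr' := hr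
    rw [gammaRatio_eq_exp hγ.le] at hr'
    refine not_isLocalMin_gammaPhase (half_pos hγ) hr' ?_
    have h3 := hcont.eventually_lt_const
      (show gammaPhase (γ₀ / 2) < gammaPhase (γ₀ / 2) + Real.pi / 2 by linarith)
    have h4 := hcont.eventually_const_lt
      (show gammaPhase (γ₀ / 2) - Real.pi / 2 < gammaPhase (γ₀ / 2) by linarith)
    filter_upwards [h2.eventually h1, h4, Ioi_mem_nhds (half_pos hγ)] with y hy hy' hy0
    by_cases hne : 2 * y = γ₀
    · rw [← hne]
      simp
    · have h5 : (gammaRatio (2 * y)).arg < 0 := by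
        by_contra! hc
        have h6 := Complex.arg_le_pi (gammaRatio (2 * y))
        linarith [hy hne, Real.sin_nonneg_of_nonneg_of_le_pi
          (x := (gammaRatio (2 * y)).arg / 2) (by linarith) (by linarith)]
      rw [Complex.arg_neg_iff, gammaRatio_eq_exp (by linarith [mem_Ioi.1 hy0]),
        mul_div_cancel_left₀ _ two_ne_zero] at h5
      have h7 : cexp (2 * gammaPhase y * I) =
          -cexp ((2 * (gammaPhase y - gammaPhase (γ₀ / 2)) : ℝ) * I) := by
        rw [neg_eq_neg_one_mul, ← hr', ← Complex.exp_add]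
        congr 1
        push_cast
        ring
      rw [h7, Complex.neg_im, Complex.exp_ofReal_mul_I_im] at h5
      by_contra! hc
      linarith [Real.sin_nonpos_of_nonpos_of_neg_pi_le
        (x := 2 * (gammaPhase y - gammaPhase (γ₀ / 2))) (by linarith) (by linarith)]

lemma analyticAt_arg_of_slitPlane {f : ℝ → ℂ} {t : ℝ} (hf : AnalyticAt ℝ f t)
    (h : f t ∈ Complex.slitPlane) : AnalyticAt ℝ (fun s ↦ (f s).arg) t := by
  have h1 : AnalyticAt ℝ (fun s ↦ Complex.log (f s)) t :=
    ((analyticAt_clog h).restrictScalars (𝕜 := ℝ)).fun_comp hf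
  have h2 := AnalyticAt.fun_comp (g := ⇑Complex.imCLM) (f := fun s ↦ Complex.log (f s))
    (Complex.imCLM.analyticAt _) h1
  simpa [Complex.log_im] using h2

lemma analyticAt_RStheta {γ₀ : ℝ} (hγ : 0 < γ₀) (hz : HardyZ γ₀ = 0)
    (hz' : deriv HardyZ γ₀ ≠ 0) : AnalyticAt ℝ RStheta γ₀ := by
  have harg : AnalyticAt ℝ (fun t ↦ (gammaRatio t).arg) γ₀ := by
    by_cases h : gammaRatio γ₀ ∈ Complex.slitPlane
    · exact analyticAt_arg_of_slitPlane (analyticAt_gammaRatio γ₀) h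
    · have hr : gammaRatio γ₀ = -1 := by
        rw [Complex.mem_slitPlane_iff] at h
        push Not at h
        have h1 := Complex.sq_norm (gammaRatio γ₀)
        rw [norm_gammaRatio, Complex.normSq_apply, h.2] at h1
        refine Complex.ext ?_ (by simpa using h.2)
        rw [Complex.neg_re, Complex.one_re]
        nlinarith [h.1]
      have h1 := analyticAt_arg_of_slitPlane (analyticAt_gammaRatio γ₀).neg
        (by simp [hr])
      refine (h1.add (analyticAt_const (v := Real.pi))).congr ?_
      have hre : ∀ᶠ t in 𝓝 γ₀, (gammaRatio t).re < 0 := by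
        have hc : ContinuousAt (fun t ↦ (gammaRatio t).re) γ₀ :=
          Complex.continuous_re.continuousAt.comp (analyticAt_gammaRatio γ₀).continuousAt
        exact hc.eventually_lt_const (by simp [hr])
      filter_upwards [hre, eventually_arg_gammaRatio_nonneg hγ hz hz' hr] with t ht1 ht2
      rw [Complex.arg_nonneg_iff] at ht2
      have : (-gammaRatio t).arg = (gammaRatio t).arg - Real.pi := by
        rw [Complex.arg_neg_eq_arg_sub_pi_iff]
        rcases ht2.lt_or_eq with h | h
        · exact Or.inl h
        · exact Or.inr ⟨h.symm, ht1⟩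
      simp [this]
  have h2 := (harg.div (analyticAt_const (v := (2 : ℝ))) two_ne_zero).sub
    (((analyticAt_id (𝕜 := ℝ) (z := γ₀)).div (analyticAt_const (v := (2 : ℝ))) two_ne_zero).mul
      (analyticAt_const (v := Real.log Real.pi)))
  refine h2.congr (Eventually.of_forall fun t ↦ ?_)
  simp [RStheta_eq]

lemma eventually_ofReal_deriv_eq {f : ℝ → ℝ} {F F' : ℝ → ℂ} {t₀ : ℝ}
    (h : ∀ᶠ t in 𝓝 t₀, (f t : ℂ) = F t) (hF : ∀ᶠ t in 𝓝 t₀, HasDerivAt F (F' t) t) :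
    ∀ᶠ t in 𝓝 t₀, ((deriv f t : ℝ) : ℂ) = F' t := by
  filter_upwards [h.eventually_nhds, hF] with t ht hFt
  have h1 : HasDerivAt (fun s ↦ (f s : ℂ)) (F' t) t := hFt.congr_of_eventuallyEq ht
  have h2 : HasDerivAt f (F' t).re t := by
    simpa [Function.comp_def] using Complex.reCLM.hasFDerivAt.comp_hasDerivAt t h1
  rw [h2.deriv]
  exact h2.ofReal_comp.unique h1

/-- For a simple positive real zero `γ₀` of Hardy's Z-function and `ρ₀ = 1/2 + iγ₀`,
`F̃(ρ₀) = (ζ'''/ζ' − (3/4)(ζ''/ζ')²)(ρ₀) = F̂(γ₀) + 3iϑ''(γ₀)`, and this is the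
decomposition of `F̃(ρ₀)` into real and imaginary parts. -/
theorem Ftilde_decomposition (γ₀ : ℝ) (hγ : 0 < γ₀)
    (hz : HardyZ γ₀ = 0) (hz' : deriv HardyZ γ₀ ≠ 0) :
    iteratedDeriv 3 riemannZeta (1 / 2 + Complex.I * γ₀) /
        deriv riemannZeta (1 / 2 + Complex.I * γ₀)
      - 3 / 4 * (iteratedDeriv 2 riemannZeta (1 / 2 + Complex.I * γ₀) /
          deriv riemannZeta (1 / 2 + Complex.I * γ₀)) ^ 2
      = ((Fhat γ₀ : ℝ) : ℂ) + 3 * Complex.I * ((iteratedDeriv 2 RStheta γ₀ : ℝ) : ℂ) ∧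
    (iteratedDeriv 3 riemannZeta (1 / 2 + Complex.I * γ₀) /
        deriv riemannZeta (1 / 2 + Complex.I * γ₀)
      - 3 / 4 * (iteratedDeriv 2 riemannZeta (1 / 2 + Complex.I * γ₀) /
          deriv riemannZeta (1 / 2 + Complex.I * γ₀)) ^ 2).re = Fhat γ₀ ∧
    (iteratedDeriv 3 riemannZeta (1 / 2 + Complex.I * γ₀) /
        deriv riemannZeta (1 / 2 + Complex.I * γ₀)
      - 3 / 4 * (iteratedDeriv 2 riemannZeta (1 / 2 + Complex.I * γ₀) /
          deriv riemannZeta (1 / 2 + Complex.I * γ₀)) ^ 2).im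
        = 3 * iteratedDeriv 2 RStheta γ₀ := by
  have hθ := (analyticAt_RStheta hγ hz hz').eventually_analyticAt
  set ζd : ℕ → ℝ → ℂ := fun k t ↦ I ^ k * iteratedDeriv k riemannZeta (1 / 2 + I * t) with hζd
  set E : ℝ → ℂ := fun t ↦ cexp (I * RStheta t) with hE
  set θ₁ : ℝ → ℝ := deriv RStheta with hθ₁
  set θ₂ : ℝ → ℝ := deriv θ₁ with hθ₂
  set θ₃ : ℝ → ℝ := deriv θ₂ with hθ₃
  have dζ (k : ℕ) (t : ℝ) : HasDerivAt (ζd k) (ζd (k + 1) t) t :=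
    hasDerivAt_iteratedDeriv_zeta k t
  have dE : ∀ᶠ t in 𝓝 γ₀, HasDerivAt E (E t * (I * θ₁ t)) t := by
    filter_upwards [hθ] with t ht
    exact (ht.differentiableAt.hasDerivAt.ofReal_comp.const_mul I).cexp
  have dθ₁ : ∀ᶠ t in 𝓝 γ₀, HasDerivAt (fun t ↦ (θ₁ t : ℂ)) (θ₂ t) t := by
    filter_upwards [hθ] with t ht
    exact ht.deriv.differentiableAt.hasDerivAt.ofReal_comp
  have dθ₂ : ∀ᶠ t in 𝓝 γ₀, HasDerivAt (fun t ↦ (θ₂ t : ℂ)) (θ₃ t) t := by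
    filter_upwards [hθ] with t ht
    exact ht.deriv.deriv.differentiableAt.hasDerivAt.ofReal_comp
  have hZ0 : ∀ᶠ t in 𝓝 γ₀, (HardyZ t : ℂ) = E t * ζd 0 t :=
    Eventually.of_forall fun t ↦ by simp [hE, hζd, ofReal_HardyZ]
  have hζd1 : ζd 1 γ₀ = I * deriv riemannZeta (1 / 2 + I * γ₀) := by simp [hζd]
  have hζd2 : ζd 2 γ₀ = I ^ 2 * iteratedDeriv 2 riemannZeta (1 / 2 + I * γ₀) := rfl
  have hζd3 : ζd 3 γ₀ = I ^ 3 * iteratedDeriv 3 riemannZeta (1 / 2 + I * γ₀) := rfl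
  have hζ0 : ζd 0 γ₀ = 0 := by
    simpa [hζd] using (HardyZ_eq_zero_iff_s14 γ₀).1 hz
  have hE0 : E γ₀ ≠ 0 := Complex.exp_ne_zero _
  have i2 : iteratedDeriv 2 RStheta γ₀ = θ₂ γ₀ := by
    simp [iteratedDeriv_succ, iteratedDeriv_zero, hθ₂, hθ₁]
  clear_value ζd E θ₃ θ₂ θ₁
  have hZ1 := eventually_ofReal_deriv_eq hZ0
    (F' := fun t ↦ E t * (ζd 1 t + I * θ₁ t * ζd 0 t)) (by
      filter_upwards [dE] with t ht
      refine (ht.mul (dζ 0 t)).congr_deriv ?_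
      ring)
  have hZ2 := eventually_ofReal_deriv_eq hZ1
    (F' := fun t ↦ E t * (ζd 2 t + 2 * I * θ₁ t * ζd 1 t + (I * θ₂ t - θ₁ t ^ 2) * ζd 0 t)) (by
      filter_upwards [dE, dθ₁] with t ht h1
      refine (ht.mul ((dζ 1 t).add ((h1.const_mul I).mul (dζ 0 t)))).congr_deriv ?_
      simp only [Pi.add_apply, Pi.mul_apply]
      linear_combination (E t * θ₁ t ^ 2 * ζd 0 t) * I_sq)
  have hZ3 := eventually_ofReal_deriv_eq hZ2
    (F' := fun t ↦ E t * (ζd 3 t + 3 * I * θ₁ t * ζd 2 t +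
      (3 * I * θ₂ t - 3 * θ₁ t ^ 2) * ζd 1 t +
      (I * θ₃ t - 3 * θ₁ t * θ₂ t - I * θ₁ t ^ 3) * ζd 0 t)) (by
      filter_upwards [dE, dθ₁, dθ₂] with t ht h1 h2
      refine (ht.mul (((dζ 2 t).add ((h1.const_mul (2 * I)).mul (dζ 1 t))).add
        (((h2.const_mul I).sub (h1.pow 2)).mul (dζ 0 t)))).congr_deriv ?_
      simp only [Pi.add_apply, Pi.mul_apply, Pi.sub_apply, Pi.pow_apply]
      push_cast
      linear_combination
        (E t * θ₁ t * (2 * θ₁ t * ζd 1 t + θ₂ t * ζd 0 t)) * I_sq)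
  have e1 := hZ1.self_of_nhds
  have e2 := hZ2.self_of_nhds
  have e3 := hZ3.self_of_nhds
  have hZ1ne : ((deriv HardyZ γ₀ : ℝ) : ℂ) ≠ 0 := by exact_mod_cast hz'
  rw [hζ0] at e1 e2 e3
  have key : iteratedDeriv 3 riemannZeta (1 / 2 + I * γ₀) / deriv riemannZeta (1 / 2 + I * γ₀)
      - 3 / 4 * (iteratedDeriv 2 riemannZeta (1 / 2 + I * γ₀) /
          deriv riemannZeta (1 / 2 + I * γ₀)) ^ 2
      = ((Fhat γ₀ : ℝ) : ℂ) + 3 * I * ((iteratedDeriv 2 RStheta γ₀ : ℝ) : ℂ) := by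
    rw [Fhat, i2]
    simp only [hζd1, hζd2, hζd3, mul_zero, add_zero] at e1 e2 e3
    simp only [iteratedDeriv_succ (n := 2) (f := HardyZ), iteratedDeriv_succ (n := 1) (f := HardyZ),
      iteratedDeriv_one]
    push_cast
    rw [e1] at hZ1ne
    rw [e1, e2, e3]
    generalize iteratedDeriv 3 riemannZeta (1 / 2 + I * γ₀) = z3
    generalize iteratedDeriv 2 riemannZeta (1 / 2 + I * γ₀) = z2
    generalize deriv riemannZeta (1 / 2 + I * γ₀) = z1 at *
    have hz1 : z1 ≠ 0 := by
      rintro rfl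
      simp at hZ1ne
    have hI := I_ne_zero
    have q3 : E γ₀ * (I ^ 3 * z3 + 3 * I * θ₁ γ₀ * (I ^ 2 * z2) +
        (3 * I * θ₂ γ₀ - 3 * θ₁ γ₀ ^ 2) * (I * z1)) / (E γ₀ * (I * z1)) =
        I ^ 2 * (z3 / z1) + 3 * θ₁ γ₀ * I ^ 2 * (z2 / z1) + 3 * I * θ₂ γ₀ - 3 * θ₁ γ₀ ^ 2 := by
      field_simp
      ring
    have q2 : E γ₀ * (I ^ 2 * z2 + 2 * I * θ₁ γ₀ * (I * z1)) / (E γ₀ * (I * z1)) =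
        I * (z2 / z1 + 2 * θ₁ γ₀) := by
      field_simp
    rw [q3, q2]
    linear_combination
      (z3 / z1 + 3 * θ₁ γ₀ * (z2 / z1) - 3 / 4 * (z2 / z1 + 2 * θ₁ γ₀) ^ 2) * I_sq
  refine ⟨key, ?_, ?_⟩
  · rw [key]
    simp
  · rw [key]
    simp
end

section
/- Define ε(γ) := (2γ² − 1/2)/(γ² + 1/4)² + (1/4) Re{ζ(2, 1/4 + iγ/2)} for real γ, where ζ(s,z) is the Hurwitz zeta-function. Then for every real γ > 1 one has 0 < ε(γ) < 3/γ². -/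
/-- `ε(γ) = (2γ² − 1/2)/(γ² + 1/4)² + (1/4) Re ζ(2, 1/4 + iγ/2)`. -/
noncomputable def epsFn (γ : ℝ) : ℝ :=
  (2 * γ ^ 2 - 1 / 2) / (γ ^ 2 + 1 / 4) ^ 2 +
    1 / 4 * (hurwitzZetaTwo (1 / 4 + Complex.I * γ / 2)).re

open Filter Topology

/-- The real part of `1 / (x + iγ)²`, with `u = γ²`, differs from a telescoping difference by at
most `1 / (u (x² - 1))`. -/
lemma abs_sub_telescoping_le (a u : ℝ) (ha : 1 < a) (hu : 0 < u) :
    |(a ^ 2 - u) / (a ^ 2 + u) ^ 2 -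
      1 / 2 * ((a - 1) / ((a - 1) ^ 2 + u) - (a + 1) / ((a + 1) ^ 2 + u))| ≤
      1 / (2 * u) * (1 / (a - 1) - 1 / (a + 1)) := by
  have h1 : 0 < a - 1 := by linarith
  have h2 : 0 < a + 1 := by linarith
  set P := ((a - 1) ^ 2 + u) * ((a + 1) ^ 2 + u) with hP
  set N := 4 * a ^ 2 * u - (a ^ 2 - u) * (a ^ 2 - u - 1) with hN
  have hPpos : 0 < P := by positivity
  have hleft : (a ^ 2 - u) / (a ^ 2 + u) ^ 2 -
      1 / 2 * ((a - 1) / ((a - 1) ^ 2 + u) - (a + 1) / ((a + 1) ^ 2 + u)) =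
      N / ((a ^ 2 + u) ^ 2 * P) := by
    have e1 : (a - 1) ^ 2 + u ≠ 0 := by positivity
    have e2 : (a + 1) ^ 2 + u ≠ 0 := by positivity
    have e3 : a ^ 2 + u ≠ 0 := by positivity
    rw [hP, hN]
    field_simp
    ring
  have hright : 1 / (2 * u) * (1 / (a - 1) - 1 / (a + 1)) = 1 / (u * ((a - 1) * (a + 1))) := by
    field_simp
    ring
  have hN2 : |N| ≤ (a ^ 2 + u) * √P := by
    apply abs_le_of_sq_le_sq _ (by positivity)
    rw [mul_pow, Real.sq_sqrt hPpos.le]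
    have : (a ^ 2 + u) ^ 2 * P - N ^ 2 = 4 * a ^ 2 * u * (2 * (a ^ 2 - u) - 1) ^ 2 := by
      rw [hP, hN]; ring
    have : 0 ≤ 4 * a ^ 2 * u * (2 * (a ^ 2 - u) - 1) ^ 2 := by positivity
    linarith
  have hS : u ≤ a ^ 2 + u := by nlinarith
  have hQ : (a - 1) * (a + 1) ≤ √P := by
    apply Real.le_sqrt_of_sq_le
    have : P - ((a - 1) * (a + 1)) ^ 2 = u * ((a - 1) ^ 2 + (a + 1) ^ 2 + u) := by
      rw [hP]; ring
    have : 0 ≤ u * ((a - 1) ^ 2 + (a + 1) ^ 2 + u) := by positivity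
    linarith
  rw [hleft, hright, abs_div, abs_of_pos (by positivity : 0 < (a ^ 2 + u) ^ 2 * P),
    div_le_div_iff₀ (by positivity) (by positivity), one_mul]
  calc |N| * (u * ((a - 1) * (a + 1)))
      ≤ ((a ^ 2 + u) * √P) * ((a ^ 2 + u) * √P) := by gcongr
    _ = (a ^ 2 + u) ^ 2 * (√P * √P) := by ring
    _ = (a ^ 2 + u) ^ 2 * P := by rw [Real.mul_self_sqrt hPpos.le]

lemma hasSum_le_of_le_telescoping {f G : ℕ → ℝ} {s : ℝ} (hf : HasSum f s)
    (hG : Tendsto G atTop (𝓝 0)) (h : ∀ n, f n ≤ G n - G (n + 1)) : s ≤ G 0 := by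
  have hlim : Tendsto (fun n => G 0 - G n) atTop (𝓝 (G 0)) := by
    simpa using hG.const_sub (G 0)
  refine le_of_tendsto_of_tendsto' hf.tendsto_sum_nat hlim fun n => ?_
  rw [← Finset.sum_range_sub' G n]
  exact Finset.sum_le_sum fun i _ => h i

lemma le_hasSum_of_telescoping_le {f G : ℕ → ℝ} {s : ℝ} (hf : HasSum f s)
    (hG : Tendsto G atTop (𝓝 0)) (h : ∀ n, G n - G (n + 1) ≤ f n) : G 0 ≤ s := by
  have := hasSum_le_of_le_telescoping hf.neg (G := fun n => -G n) (by simpa using hG.neg)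
    fun n => by linarith [h n]
  linarith

lemma summable_one_div_add_nat_sq (z : ℂ) (hz : 0 < z.re) :
    Summable fun n : ℕ => 1 / (z + n) ^ 2 := by
  rw [← summable_nat_add_iff 1]
  have h : Summable fun n : ℕ => 1 / ((n + 1 : ℕ) : ℝ) ^ 2 :=
    (summable_nat_add_iff 1).2 (Real.summable_one_div_nat_pow.2 one_lt_two)
  refine Summable.of_norm_bounded h fun n => ?_
  rw [norm_div, norm_pow, norm_one]
  gcongr
  refine le_trans ?_ (Complex.re_le_norm _)
  rw [Complex.add_re, Complex.natCast_re]
  linarith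

lemma quarter_re_one_div_sq (γ : ℝ) (n : ℕ) :
    1 / 4 * (1 / (1 / 4 + Complex.I * γ / 2 + n : ℂ) ^ 2).re =
      ((2 * n + 1 / 2) ^ 2 - γ ^ 2) / ((2 * n + 1 / 2) ^ 2 + γ ^ 2) ^ 2 := by
  have hw : (1 / 4 + Complex.I * γ / 2 + n : ℂ) = ⟨(2 * n + 1 / 2) / 2, γ / 2⟩ := by
    apply Complex.ext
    · simp; ring
    · simp
  have h : (2 * n + 1 / 2 : ℝ) ^ 2 + γ ^ 2 ≠ 0 := by positivity
  have hs : ((⟨(2 * n + 1 / 2) / 2, γ / 2⟩ : ℂ) ^ 2) =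
      ⟨((2 * n + 1 / 2) ^ 2 - γ ^ 2) / 4, (2 * n + 1 / 2) * γ / 2⟩ := by
    rw [sq]
    apply Complex.ext
    · simp only [Complex.mul_re]; ring
    · simp only [Complex.mul_im]; ring
  have hnorm : (((2 * n + 1 / 2 : ℝ) ^ 2 - γ ^ 2) / 4) * (((2 * n + 1 / 2) ^ 2 - γ ^ 2) / 4) +
      ((2 * n + 1 / 2) * γ / 2) * ((2 * n + 1 / 2) * γ / 2) =
      ((2 * n + 1 / 2) ^ 2 + γ ^ 2) ^ 2 / 16 := by ring
  rw [hw, hs, one_div (_ : ℂ), Complex.inv_re, Complex.normSq_mk, hnorm]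
  field_simp
  ring

lemma hasSum_quarter_re_hurwitzZetaTwo (γ : ℝ) :
    HasSum (fun n : ℕ => ((2 * n + 1 / 2 : ℝ) ^ 2 - γ ^ 2) / ((2 * n + 1 / 2) ^ 2 + γ ^ 2) ^ 2)
      (1 / 4 * (hurwitzZetaTwo (1 / 4 + Complex.I * γ / 2)).re) := by
  have hs := (summable_one_div_add_nat_sq (1 / 4 + Complex.I * γ / 2) (by simp)).hasSum
  rw [← funext (quarter_re_one_div_sq γ)]
  exact (Complex.hasSum_re hs).mul_left (1 / 4)

lemma tendsto_telescoping_zero (u c : ℝ) (hu : 0 < u) :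
    Tendsto (fun n : ℕ => 1 / 2 * ((2 * n + 3 / 2 : ℝ) / ((2 * n + 3 / 2) ^ 2 + u)) +
      c * (1 / (2 * n + 3 / 2))) atTop (𝓝 0) := by
  have hx : Tendsto (fun n : ℕ => (2 * n + 3 / 2 : ℝ)) atTop atTop :=
    tendsto_atTop_add_const_right _ _
      (tendsto_natCast_atTop_atTop.const_mul_atTop (by norm_num))
  have hinv : Tendsto (fun n : ℕ => 1 / (2 * n + 3 / 2 : ℝ)) atTop (𝓝 0) := by
    simpa only [one_div, Function.comp_def] using tendsto_inv_atTop_zero.comp hx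
  have hfrac : Tendsto (fun n : ℕ => (2 * n + 3 / 2 : ℝ) / ((2 * n + 3 / 2) ^ 2 + u))
      atTop (𝓝 0) := by
    refine squeeze_zero (fun n => by positivity) (fun n => ?_) hinv
    rw [div_le_div_iff₀ (by positivity) (by positivity)]
    nlinarith
  simpa only [mul_zero, add_zero] using (hfrac.const_mul (1 / 2)).add (hinv.const_mul c)

/-- For every real `γ > 1`, `0 < ε(γ) < 3/γ²`. -/
theorem eps_bounds (γ : ℝ) (hγ : 1 < γ) : 0 < epsFn γ ∧ epsFn γ < 3 / γ ^ 2 := by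
  have hu : 1 < γ ^ 2 := by nlinarith
  have htail := (hasSum_nat_add_iff' 1).2 (hasSum_quarter_re_hurwitzZetaTwo γ)
  have heps : epsFn γ = (2 * γ ^ 2 - 1 / 2) / (γ ^ 2 + 1 / 4) ^ 2 +
    1 / 4 * (hurwitzZetaTwo (1 / 4 + Complex.I * γ / 2)).re := rfl
  rw [heps]
  generalize 1 / 4 * (hurwitzZetaTwo (1 / 4 + Complex.I * γ / 2)).re = Z at *
  generalize γ ^ 2 = u at *
  have hu0 : 0 < u := by linarith
  have hterm (n : ℕ) := abs_le.1 (abs_sub_telescoping_le (2 * n + 5 / 2) u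
    (by have : (0 : ℝ) ≤ n := n.cast_nonneg
        linarith) hu0)
  have hcast (n : ℕ) : (2 * ((n + 1 : ℕ) : ℝ) + 1 / 2) = 2 * n + 5 / 2 := by push_cast; ring
  have hcast' (n : ℕ) : (2 * ((n + 1 : ℕ) : ℝ) + 3 / 2) = 2 * n + 5 / 2 + 1 := by
    push_cast; ring
  have hpred (n : ℕ) : (2 * (n : ℝ) + 3 / 2) = 2 * n + 5 / 2 - 1 := by ring
  have hupper := hasSum_le_of_le_telescoping htail
    (tendsto_telescoping_zero u (1 / (2 * u)) hu0) fun n => by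
      rw [hcast, hcast', hpred]
      linarith [(hterm n).2]
  have hlower := le_hasSum_of_telescoping_le htail
    (tendsto_telescoping_zero u (-(1 / (2 * u))) hu0) fun n => by
      rw [hcast, hcast', hpred]
      linarith [(hterm n).1]
  have hhead : (1 / 2 ^ 2 - u) / (1 / 2 ^ 2 + u) ^ 2 = -((u - 1 / 4) / (u + 1 / 4) ^ 2) := by
    rw [← neg_div]
    ring
  have hmain : (2 * u - 1 / 2) / (u + 1 / 4) ^ 2 = 2 * ((u - 1 / 4) / (u + 1 / 4) ^ 2) := by
    ring
  simp only [Finset.sum_range_one, Nat.cast_zero, mul_zero, zero_add, div_pow, one_pow,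
    hhead] at hupper hlower
  have herr : 1 / (2 * u) * (1 / (3 / 2)) = 1 / 3 * (1 / u) := by
    field_simp
  have hG : 0 < 3 / 2 / (3 ^ 2 / 2 ^ 2 + u) := by positivity
  have hG' : 3 / 2 / (3 ^ 2 / 2 ^ 2 + u) < 3 / 2 * (1 / u) := by
    rw [mul_one_div]
    gcongr
    linarith
  have hA : 1 / 3 * (1 / u) < (u - 1 / 4) / (u + 1 / 4) ^ 2 := by
    rw [one_div_mul_one_div, div_lt_div_iff₀ (by positivity) (by positivity)]
    nlinarith
  have hA' : (u - 1 / 4) / (u + 1 / 4) ^ 2 < 1 / u := by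
    rw [div_lt_div_iff₀ (by positivity) (by positivity)]
    nlinarith
  have hu3 : 3 / u = 3 * (1 / u) := by ring
  have hinv : 0 < 1 / u := by positivity
  rw [hmain, hu3]
  rw [neg_mul, herr] at hlower
  rw [herr] at hupper
  constructor <;> linarith
end
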